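/- arXiv:math/0405459 — 3 statements merged into one kernel-verified Lean document; each statement's English description precedes it below -/
import Mathlib

section
/- Let T be large, set δ = 50 (log log T)/(log T), and let x > 1 satisfy δ log x < 1. Then the sum of x^{iγ}(1 − x^{β−1/2}) over the nontrivial zeros ρ = β + iγ of the Riemann zeta function with 0 < γ ≤ T and |β − 1/2| ≥ δ, counted with multiplicity, is ≪ T / log¹⁰ T, with an absolute implied constant. -/
open Filter MeasureTheory Real Complex Set

open Classical in
/-- Multiplicity of a point as a zero of the Riemann zeta function. -/
noncomputable def zetaZeroMult (ρ : ℂ) : ℕ :=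
  if h : AnalyticAt ℂ riemannZeta ρ then (analyticOrderAt riemannZeta ρ).toNat else 0

/-- Nontrivial zeros with imaginary part in `(0, T]`. -/
def zetaZerosUpTo (T : ℝ) : Set ℂ :=
  {ρ : ℂ | riemannZeta ρ = 0 ∧ 0 < ρ.re ∧ ρ.re < 1 ∧ 0 < ρ.im ∧ ρ.im ≤ T}

/-- `N(T)`: number of nontrivial zeros with `0 < γ ≤ T`, counted with multiplicity. -/
noncomputable def zetaN (T : ℝ) : ℕ := ∑ᶠ ρ ∈ zetaZerosUpTo T, zetaZeroMult ρ

/-- Explicit density `g` when `α = a log p / (2 π q)`. -/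
noncomputable def gPAQ (p a q : ℕ) (t : ℝ) : ℝ :=
  -(((p : ℝ) ^ ((a : ℝ) / 2) * Real.cos (2 * π * q * t) - 1) * Real.log p) /
    (π * ((p : ℝ) ^ (a : ℝ) - 2 * (p : ℝ) ^ ((a : ℝ) / 2) * Real.cos (2 * π * q * t) + 1))

/-- `α` has the special form `a log p / (2 π q)` with `p` prime, `a, q` coprime positive. -/
def IsSpecialForm (α : ℝ) (p a q : ℕ) : Prop :=
  p.Prime ∧ 0 < a ∧ 0 < q ∧ Nat.Coprime a q ∧ α = a * Real.log p / (2 * π * q)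

/-- `g` is the density `g_α` associated with `α`. -/
def IsDensityOf (α : ℝ) (g : ℝ → ℝ) : Prop :=
  (∀ p a q : ℕ, IsSpecialForm α p a q → g = gPAQ p a q) ∧
    ((¬ ∃ p a q : ℕ, IsSpecialForm α p a q) → g = 0)

/-- Sum of `h(αγ)` over zeros with `0 < γ ≤ T`, with multiplicity; `h` is `1`-periodic so this
equals the sum of `h({αγ})`. -/
noncomputable def zetaZeroSum (α : ℝ) (h : ℝ → ℂ) (T : ℝ) : ℂ :=
  ∑ᶠ ρ ∈ zetaZerosUpTo T, (zetaZeroMult ρ : ℂ) * h (α * ρ.im)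

/-- `h` is (a lift of) an absolutely continuous function on `𝕋 = ℝ/ℤ`, with derivative `h'`. -/
def IsAbsContTorus (h h' : ℝ → ℂ) : Prop :=
  Function.Periodic h 1 ∧ Function.Periodic h' 1 ∧
    (∀ a b : ℝ, IntervalIntegrable h' volume a b) ∧
    ∀ y : ℝ, h y = h 0 + ∫ t in (0:ℝ)..y, h' t

/-- `L¹` modulus of continuity on the torus. -/
noncomputable def modCont (f : ℝ → ℂ) (δ : ℝ) : ℝ :=
  sSup ((fun u => ∫ t in (0:ℝ)..1, ‖f (t + u) - f t‖) '' Set.Icc (-δ) δ)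

/-- `M_α(y;T)`. -/
noncomputable def Mfun (α y T : ℝ) : ℝ :=
  (1 / T) * (∑ᶠ ρ ∈ {ρ : ℂ | riemannZeta ρ = 0 ∧ 0 < ρ.re ∧ ρ.re < 1 ∧ 0 < ρ.im ∧ ρ.im ≤ T ∧
      Int.fract (α * ρ.im) < y}, (zetaZeroMult ρ : ℝ)) - y * (zetaN T) / T

/-- Normalized discrepancy `D*_α(T)`. -/
noncomputable def Dstar (α T : ℝ) : ℝ :=
  sSup ((fun y => (T / (zetaN T)) * |Mfun α y T|) '' Set.Icc (0:ℝ) 1)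

lemma fz_int_exp (l H : ℝ) (hl : l ≠ 0) :
    ‖∫ t in (-H)..H, Complex.exp (l * I * t)‖ ≤ 2 / |l| := by
  have hc : (l * I : ℂ) ≠ 0 := by simp [hl]
  rw [integral_exp_mul_complex hc, norm_div]
  have h1 : ‖(l * I : ℂ)‖ = |l| := by simp
  rw [h1]
  gcongr
  refine (norm_sub_le _ _).trans ?_
  have : ∀ x : ℝ, ‖Complex.exp (l * I * x)‖ = 1 := by
    intro x
    rw [show (l * I * x : ℂ) = ((l * x : ℝ) : ℂ) * I by push_cast; ring, Complex.norm_exp_ofReal_mul_I]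
  have h2 := this H
  have h3 := this (-H)
  rw [h2, h3]; norm_num

lemma fz_log_diff (m n N : ℕ) (hm : 1 ≤ m) (hn : 1 ≤ n) (hmN : m ≤ N) (hnN : n ≤ N) :
    |(m : ℝ) - n| / N ≤ |Real.log m - Real.log n| := by
  wlog h : n ≤ m generalizing m n
  · have := this n m hn hm hnN hmN (by omega)
    rwa [abs_sub_comm, abs_sub_comm (Real.log m)]
  have hm0 : (0 : ℝ) < m := by exact_mod_cast hm
  have hn0 : (0 : ℝ) < n := by exact_mod_cast hn
  have hN0 : (0 : ℝ) < N := by exact_mod_cast (by omega : 0 < N)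
  have h' : (n : ℝ) ≤ m := by exact_mod_cast h
  have h'' : (m : ℝ) ≤ N := by exact_mod_cast hmN
  rw [abs_of_nonneg (by linarith), abs_of_nonneg (by linarith [Real.log_le_log hn0 h'])]
  have h1 := Real.log_le_sub_one_of_pos (div_pos hn0 hm0)
  rw [Real.log_div hn0.ne' hm0.ne'] at h1
  have h2 : ((m : ℝ) - n) / N ≤ (m - n) / m := by
    apply div_le_div_of_nonneg_left _ hm0 h''
    linarith
  have h3 : ((m : ℝ) - n) / m = 1 - n / m := by field_simp
  linarith

lemma fz_harm (N : ℕ) : ∑ k ∈ Finset.Icc 1 N, (1 : ℝ) / k ≤ 1 + Real.log N := by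
  have := harmonic_le_one_add_log N
  rw [harmonic_eq_sum_Icc] at this
  push_cast at this
  simpa [one_div] using this

lemma fz_inner_sum (m N : ℕ) (hm : 1 ≤ m) (hmN : m ≤ N) :
    ∑ n ∈ Finset.Icc 1 N, (if n = m then (0:ℝ) else 2 / |Real.log m - Real.log n|)
      ≤ 4 * N * (1 + Real.log N) := by
  have hN0 : (0 : ℝ) < N := by exact_mod_cast (by omega : 0 < N)
  have key : ∀ n ∈ Finset.Icc 1 N, (if n = m then (0:ℝ) else 2 / |Real.log m - Real.log n|)
      ≤ ∑ k ∈ Finset.Icc 1 N, ((if n = m + k then 2 * N * ((1:ℝ)/k) else 0) +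
        (if n + k = m then 2 * N * ((1:ℝ)/k) else 0)) := by
    intro n hn
    rw [Finset.mem_Icc] at hn
    have hnonneg : ∀ k ∈ Finset.Icc 1 N, 0 ≤ ((if n = m + k then 2 * N * ((1:ℝ)/k) else 0) +
        (if n + k = m then 2 * N * ((1:ℝ)/k) else 0)) := by
      intro k hk; split_ifs <;> positivity
    split_ifs with h
    · exact Finset.sum_nonneg hnonneg
    have hne : |(m:ℝ) - n| ≠ 0 := by
      rw [abs_ne_zero, sub_ne_zero]; intro h'; exact h (by exact_mod_cast h'.symm)
    have hpos : 0 < |(m:ℝ) - n| := lt_of_le_of_ne (abs_nonneg _) hne.symm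
    have h1 := fz_log_diff m n N hm hn.1 hmN hn.2
    have h2 : 2 / |Real.log m - Real.log n| ≤ 2 * N * (1 / |(m:ℝ) - n|) := by
      calc 2 / |Real.log m - Real.log n| ≤ 2 / (|(m : ℝ) - n| / N) := by
            apply div_le_div_of_nonneg_left (by norm_num) (by positivity) h1
        _ = _ := by field_simp
    refine h2.trans ?_
    rcases lt_or_gt_of_ne h with h3 | h3
    · refine le_trans (le_of_eq ?_) (Finset.single_le_sum hnonneg
        (Finset.mem_Icc.2 ⟨(by omega : 1 ≤ m - n), by omega⟩))
      have : ¬ n = m + (m - n) := by omega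
      have h4 : n + (m - n) = m := by omega
      have h5 : (n:ℝ) < m := by exact_mod_cast h3
      simp only [this, h4, if_true, if_false, zero_add]
      rw [abs_of_pos (by linarith), Nat.cast_sub h3.le]
    · refine le_trans (le_of_eq ?_) (Finset.single_le_sum hnonneg
        (Finset.mem_Icc.2 ⟨(by omega : 1 ≤ n - m), by omega⟩))
      have : n = m + (n - m) := by omega
      have h4 : ¬ n + (n - m) = m := by omega
      have h5 : (m:ℝ) < n := by exact_mod_cast h3
      rw [if_pos this, if_neg h4, add_zero]
      rw [abs_of_neg (by linarith), Nat.cast_sub h3.le, neg_sub]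
  refine (Finset.sum_le_sum key).trans ?_
  rw [Finset.sum_comm]
  have : ∀ k ∈ Finset.Icc 1 N, ∑ n ∈ Finset.Icc 1 N, ((if n = m + k then 2 * N * ((1:ℝ)/k) else 0) +
        (if n + k = m then 2 * N * ((1:ℝ)/k) else 0)) ≤ 4 * N * ((1:ℝ)/k) := by
    intro k hk
    rw [Finset.mem_Icc] at hk
    rw [Finset.sum_add_distrib, Finset.sum_ite_eq' ]
    have e : ∀ n, (n + k = m) ↔ (n = m - k ∧ k ≤ m) := by intro n; omega
    have h1 : (if m + k ∈ Finset.Icc 1 N then 2 * (N:ℝ) * (1 / (k:ℝ)) else 0) ≤ 2 * N * (1 / (k:ℝ)) := by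
      split_ifs <;> first | exact le_rfl | positivity
    have h2 : ∑ n ∈ Finset.Icc 1 N, (if n + k = m then 2 * N * ((1:ℝ)/k) else 0) ≤ 2 * N * (1 / (k:ℝ)) := by
      calc _ ≤ ∑ n ∈ Finset.Icc 1 N, (if n = m - k then 2 * N * ((1:ℝ)/k) else 0) := by
            apply Finset.sum_le_sum
            intro n hn
            split_ifs with h3 h4 h4 <;> first | exact le_rfl | positivity | (exfalso; omega)
        _ ≤ _ := by
            rw [Finset.sum_ite_eq']
            split_ifs <;> first | exact le_rfl | positivity
    linarith
  refine (Finset.sum_le_sum this).trans ?_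
  rw [← Finset.mul_sum]
  gcongr
  exact fz_harm N

lemma fz_mv (a : ℕ → ℂ) (N : ℕ) (H : ℝ) (hH : 0 ≤ H) :
    ∫ t in (-H)..H, ‖∑ n ∈ Finset.Icc 1 N, a n * Complex.exp (-(Real.log n) * I * t)‖ ^ 2
      ≤ (2 * H + 4 * N * (1 + Real.log N)) * ∑ n ∈ Finset.Icc 1 N, ‖a n‖ ^ 2 := by
  set S := Finset.Icc 1 N with hS
  have expand : ∀ t : ℝ, ((‖∑ n ∈ S, a n * Complex.exp (-(Real.log n) * I * t)‖ ^ 2 : ℝ) : ℂ)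
      = ∑ m ∈ S, ∑ n ∈ S, (a n * (starRingEnd ℂ) (a m)) *
          Complex.exp (((Real.log m - Real.log n : ℝ) : ℂ) * I * t) := by
    intro t
    rw [← Complex.normSq_eq_norm_sq, ← Complex.mul_conj, map_sum, Finset.sum_mul_sum, Finset.sum_comm]
    refine Finset.sum_congr rfl fun m _ => Finset.sum_congr rfl fun n _ => ?_
    rw [map_mul, ← Complex.exp_conj]
    rw [mul_mul_mul_comm, ← Complex.exp_add]
    congr 2
    simp only [map_mul, map_neg, conj_ofReal, conj_I]
    push_cast; ring
  have hInt0 : ∀ m n : ℕ, IntervalIntegrable (fun t : ℝ => (a n * (starRingEnd ℂ) (a m)) *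
          Complex.exp (((Real.log m - Real.log n : ℝ) : ℂ) * I * t)) volume (-H) H := by
    intro m n
    apply Continuous.intervalIntegrable
    fun_prop
  have h1 : ((∫ t in (-H)..H, ‖∑ n ∈ S, a n * Complex.exp (-(Real.log n) * I * t)‖ ^ 2 : ℝ) : ℂ)
      = ∑ m ∈ S, ∑ n ∈ S, (a n * (starRingEnd ℂ) (a m)) * ∫ t in (-H)..H,
          Complex.exp (((Real.log m - Real.log n : ℝ) : ℂ) * I * t) := by
    rw [← intervalIntegral.integral_ofReal]
    simp_rw [expand]
    rw [intervalIntegral.integral_finsetSum]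
    · refine Finset.sum_congr rfl fun m _ => ?_
      rw [intervalIntegral.integral_finsetSum]
      · refine Finset.sum_congr rfl fun n _ => ?_
        rw [intervalIntegral.integral_const_mul]
      · intro n _; exact hInt0 m n
    · intro m _
      apply Continuous.intervalIntegrable
      fun_prop
  have h2 : ∀ m ∈ S, ∀ n ∈ S, ‖∫ t in (-H)..H,
          Complex.exp (((Real.log m - Real.log n : ℝ) : ℂ) * I * t)‖ ≤
          (if n = m then 2 * H else 0) + (if n = m then (0:ℝ) else 2 / |Real.log m - Real.log n|) := by
    intro m hm n hn
    simp only [hS, Finset.mem_Icc] at hm hn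
    split_ifs with h
    · subst h
      have : ‖((H:ℂ) + H)‖ = 2 * H := by
        rw [← Complex.ofReal_add, Complex.norm_real, Real.norm_eq_abs, abs_of_nonneg (by linarith)]
        ring
      simp [this]
    · rw [zero_add]
      apply fz_int_exp
      rw [sub_ne_zero]
      intro h3
      have := Real.log_injOn_pos (show (m:ℝ) ∈ Ioi 0 by simp; omega) (show (n:ℝ) ∈ Ioi 0 by simp; omega) h3
      exact h (by exact_mod_cast this.symm)
  set K : ℕ → ℕ → ℝ := fun m n => (if n = m then 2 * H else 0) +
    (if n = m then (0:ℝ) else 2 / |Real.log m - Real.log n|) with hK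
  have hKs : ∀ m n, K m n = K n m := by
    intro m n
    simp only [hK]
    rw [abs_sub_comm]
    simp only [eq_comm]
  have hK0 : ∀ m n, 0 ≤ K m n := by
    intro m n; simp only [hK]; split_ifs <;> positivity
  have hKsum : ∀ m ∈ S, ∑ n ∈ S, K m n ≤ 2 * H + 4 * N * (1 + Real.log N) := by
    intro m hm
    have hm' := Finset.mem_Icc.1 hm
    simp only [hK]
    rw [Finset.sum_add_distrib, Finset.sum_ite_eq', if_pos hm]
    gcongr
    exact fz_inner_sum m N hm'.1 hm'.2
  have h3 : (∫ t in (-H)..H, ‖∑ n ∈ S, a n * Complex.exp (-(Real.log n) * I * t)‖ ^ 2)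
      ≤ ∑ m ∈ S, ∑ n ∈ S, (‖a n‖ * ‖a m‖) * K m n := by
    refine (le_abs_self _).trans ?_
    rw [← Real.norm_eq_abs, ← Complex.norm_real, h1]
    refine (norm_sum_le _ _).trans (Finset.sum_le_sum fun m hm => ?_)
    refine (norm_sum_le _ _).trans (Finset.sum_le_sum fun n hn => ?_)
    rw [norm_mul, norm_mul, RCLike.norm_conj]
    gcongr
    exact h2 m hm n hn
  refine h3.trans ?_
  have h4 : ∑ m ∈ S, ∑ n ∈ S, (‖a n‖ * ‖a m‖) * K m n ≤
      ∑ m ∈ S, ∑ n ∈ S, (‖a n‖ ^ 2 / 2 * K n m + ‖a m‖ ^ 2 / 2 * K m n) := by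
    refine Finset.sum_le_sum fun m hm => Finset.sum_le_sum fun n hn => ?_
    rw [hKs n m, ← add_mul]
    apply mul_le_mul_of_nonneg_right _ (hK0 _ _)
    nlinarith [sq_nonneg (‖a n‖ - ‖a m‖)]
  refine h4.trans ?_
  have h5 : ∑ m ∈ S, ∑ n ∈ S, (‖a n‖ ^ 2 / 2 * K n m + ‖a m‖ ^ 2 / 2 * K m n) =
      ∑ m ∈ S, ‖a m‖ ^ 2 * ∑ n ∈ S, K m n := by
    simp_rw [Finset.sum_add_distrib]
    rw [Finset.sum_comm, ← Finset.sum_add_distrib]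
    refine Finset.sum_congr rfl fun m _ => ?_
    rw [← Finset.mul_sum]; ring
  rw [h5, mul_comm, Finset.sum_mul]
  refine Finset.sum_le_sum fun m hm => ?_
  exact mul_le_mul_of_nonneg_left (hKsum m hm) (by positivity)

open scoped FourierTransform SchwartzMap in
lemma fz_fourier_ae (f : ℝ → ℂ) (h1 : Integrable f) (h2 : MemLp f 2) :
    (𝓕 (h2.toLp f) : Lp ℂ 2 (volume : Measure ℝ)) =ᵐ[volume] (𝓕 f : ℝ → ℂ) := by
  have hcont : Continuous (𝓕 f) :=
    VectorFourier.fourierIntegral_continuous Real.continuous_fourierChar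
      (by exact continuous_inner) h1
  apply ae_eq_of_integral_contDiff_smul_eq
  · exact (Lp.memLp _).locallyIntegrable (by norm_num)
  · exact hcont.locallyIntegrable
  intro g hg hgc
  have hgC : ContDiff ℝ (↑(⊤ : ℕ∞)) (fun x => (g x : ℂ)) := Complex.ofRealCLM.contDiff.comp hg
  have hgcC : HasCompactSupport (fun x => (g x : ℂ)) := hgc.comp_left (g := fun x : ℝ => (x : ℂ)) (by simp)
  set φ : 𝓢(ℝ, ℂ) := hgcC.toSchwartzMap hgC with hφ
  have hφx : ∀ x, φ x = (g x : ℂ) := fun x => rfl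
  have e1 := congrArg (fun u => u φ) (Lp.fourier_toTemperedDistribution_eq (h2.toLp f))
  simp only [TemperedDistribution.fourier_apply, Lp.toTemperedDistribution_apply] at e1
  have e2 : ∫ x, (g x) • ((𝓕 (h2.toLp f) : Lp ℂ 2 (volume : Measure ℝ)) x) =
      ∫ x, φ x • ((𝓕 (h2.toLp f) : Lp ℂ 2 (volume : Measure ℝ)) x) := by
    simp [hφx]
  rw [e2, ← e1]
  have e3 : ∫ x, (𝓕 φ) x • (h2.toLp f) x = ∫ x, (𝓕 φ) x • f x := by
    apply integral_congr_ae
    filter_upwards [h2.coeFn_toLp] with x hx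
    rw [hx]
  rw [e3, SchwartzMap.fourier_coe]
  have e4 := VectorFourier.integral_fourierIntegral_smul_eq_flip (e := 𝐞) (μ := volume) (ν := volume)
    (L := innerₗ ℝ) (f := (φ : ℝ → ℂ)) (g := f) Real.continuous_fourierChar
      (by exact continuous_inner) φ.integrable h1
  rw [flip_innerₗ] at e4
  exact e4

open scoped FourierTransform in
lemma fz_plancherel (f : ℝ → ℂ) (h1 : Integrable f) (h2 : MemLp f 2) :
    Integrable (fun w => ‖𝓕 f w‖ ^ 2) ∧ ∫ w, ‖𝓕 f w‖ ^ 2 = ∫ x, ‖f x‖ ^ 2 := by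
  have hae := fz_fourier_ae f h1 h2
  have hm : MemLp (𝓕 f) 2 := (memLp_congr_ae hae).1 (Lp.memLp _)
  refine ⟨hm.integrable_norm_pow (by norm_num), ?_⟩
  have hn := Lp.norm_fourier_eq (h2.toLp f)
  rw [Lp.norm_def, Lp.norm_def, eLpNorm_congr_ae hae, eLpNorm_congr_ae h2.coeFn_toLp,
    hm.eLpNorm_eq_integral_rpow_norm (by norm_num) (by norm_num),
    h2.eLpNorm_eq_integral_rpow_norm (by norm_num) (by norm_num)] at hn
  simp only [ENNReal.toReal_ofNat, Real.rpow_ofNat] at hn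
  rw [ENNReal.toReal_ofReal (by positivity), ENNReal.toReal_ofReal (by positivity)] at hn
  have p1 : 0 ≤ ∫ w, ‖𝓕 f w‖ ^ 2 := integral_nonneg fun _ => by positivity
  have p2 : 0 ≤ ∫ x, ‖f x‖ ^ 2 := integral_nonneg fun _ => by positivity
  exact Real.rpow_left_injOn (by norm_num : (2:ℝ)⁻¹ ≠ 0) p1 p2 hn

open scoped FourierTransform in
lemma fz_plancherel' (f : ℝ → ℂ) (h1 : Integrable f) (h2 : MemLp f 2) (H : ℝ) (hH : 0 ≤ H) :
    ∫ t in (-H)..H, ‖∫ u, f u * Complex.exp (-(u * t) * I)‖ ^ 2 ≤ 2 * π * ∫ x, ‖f x‖ ^ 2 := by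
  obtain ⟨hi, he⟩ := fz_plancherel f h1 h2
  have e1 : ∀ t : ℝ, (∫ u, f u * Complex.exp (-(u * t) * I)) = 𝓕 f (t / (2 * π)) := by
    intro t
    rw [Real.fourier_real_eq_integral_exp_smul]
    congr 1; ext u
    rw [smul_eq_mul, mul_comm]
    congr 2
    have : (π : ℂ) ≠ 0 := by exact_mod_cast Real.pi_ne_zero
    push_cast; field_simp
  simp_rw [e1]
  have h3 : Integrable (fun t : ℝ => ‖𝓕 f (t / (2 * π))‖ ^ 2) :=
    hi.comp_div (by positivity)
  rw [intervalIntegral.integral_of_le (by linarith)]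
  refine (setIntegral_le_integral h3 (ae_of_all _ fun _ => by positivity)).trans ?_
  rw [Measure.integral_comp_div (fun w => ‖𝓕 f w‖ ^ 2), he, abs_of_pos (by positivity), smul_eq_mul]

/-- The fractional part integral. -/
noncomputable def fzI (N : ℕ) (s : ℂ) : ℂ := ∫ x in Ioi (N : ℝ), ((Int.fract x : ℝ) : ℂ) * (x : ℂ) ^ (-s - 1)

lemma fzI_integrable (N : ℕ) (hN : 1 ≤ N) (s : ℂ) (hs : 0 < s.re) :
    IntegrableOn (fun x : ℝ => ((Int.fract x : ℝ) : ℂ) * (x : ℂ) ^ (-s - 1)) (Ioi (N : ℝ)) := by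
  have hN0 : (0:ℝ) < N := by exact_mod_cast hN
  have h1 : IntegrableOn (fun x : ℝ => (x : ℂ) ^ (-s - 1)) (Ioi (N : ℝ)) :=
    integrableOn_Ioi_cpow_of_lt (by simp; linarith) hN0
  refine Integrable.mono h1 ?_ ?_
  · refine AEStronglyMeasurable.mul ?_ h1.aestronglyMeasurable
    exact (Complex.measurable_ofReal.comp measurable_fract).aestronglyMeasurable
  · refine ae_of_all _ fun x => ?_
    rw [norm_mul]
    refine mul_le_of_le_one_left (norm_nonneg _) ?_
    rw [Complex.norm_real, Real.norm_eq_abs, abs_of_nonneg (Int.fract_nonneg x)]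
    exact (Int.fract_lt_one x).le

lemma fzI_norm (N : ℕ) (hN : 1 ≤ N) (s : ℂ) (hs : 0 < s.re) :
    ‖fzI N s‖ ≤ (N : ℝ) ^ (-s.re) / s.re := by
  have hN0 : (0:ℝ) < N := by exact_mod_cast hN
  have h2 : ∫ x in Ioi (N : ℝ), x ^ (-s.re - 1) = (N : ℝ) ^ (-s.re) / s.re := by
    rw [integral_Ioi_rpow_of_lt (by linarith) hN0]
    rw [sub_add_cancel, neg_div_neg_eq]
  rw [← h2]
  apply norm_integral_le_of_norm_le (integrableOn_Ioi_rpow_of_lt (by linarith) hN0)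
  filter_upwards [ae_restrict_mem measurableSet_Ioi] with x hx
  have hx0 : 0 < x := hN0.trans hx
  rw [norm_mul, Complex.norm_cpow_eq_rpow_re_of_pos hx0]
  have : (-s - 1).re = -s.re - 1 := by simp
  rw [this]
  refine mul_le_of_le_one_left (by positivity) ?_
  rw [Complex.norm_real, Real.norm_eq_abs, abs_of_nonneg (Int.fract_nonneg x)]
  exact (Int.fract_lt_one x).le

lemma fzI_step (N : ℕ) (hN : 1 ≤ N) (s : ℂ) (hs : 0 < s.re) (hs1 : s ≠ 1) :
    s * (fzI N s - fzI (N + 1) s) = ((N + 1 : ℕ) ^ (1 - s) - (N:ℂ) ^ (1 - s)) / (1 - s) -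
      ((N + 1 : ℕ) : ℂ) ^ (-s) := by
  have hN0 : (0:ℝ) < N := by exact_mod_cast hN
  have hs0 : s ≠ 0 := by rintro rfl; simp at hs
  have h0 : fzI N s - fzI (N + 1) s = ∫ x in (N:ℝ)..(N+1:ℕ), ((Int.fract x : ℝ) : ℂ) * (x : ℂ) ^ (-s - 1) := by
    rw [fzI, fzI, intervalIntegral.integral_Ioi_sub_Ioi (fzI_integrable N hN s hs)]
    push_cast; linarith
  have h1 : ∫ x in (N:ℝ)..(N+1:ℕ), ((Int.fract x : ℝ) : ℂ) * (x : ℂ) ^ (-s - 1) =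
      ∫ x in (N:ℝ)..(N+1:ℕ), ((x : ℂ) ^ (-s) - N * (x : ℂ) ^ (-s - 1)) := by
    have hle : (N:ℝ) ≤ ((N+1 : ℕ):ℝ) := by push_cast; linarith
    rw [intervalIntegral.integral_of_le hle, intervalIntegral.integral_of_le hle,
      integral_Ioc_eq_integral_Ioo, integral_Ioc_eq_integral_Ioo]
    refine setIntegral_congr_fun measurableSet_Ioo fun x hx => ?_
    push_cast at hx
    have hx0 : 0 < x := hN0.trans hx.1
    have hxc : (x : ℂ) ≠ 0 := by exact_mod_cast hx0.ne'
    have hf : Int.fract x = x - N := by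
      rw [Int.fract_eq_iff]
      refine ⟨by linarith [hx.1], by linarith [hx.2], N, by simp⟩
    have : (x : ℂ) ^ (-s) = x * (x : ℂ) ^ (-s - 1) := by
      rw [Complex.cpow_sub _ _ hxc, Complex.cpow_one]; field_simp
    simp only [hf, this]; push_cast; ring
  have hne : (0:ℝ) ∉ uIcc (N:ℝ) ((N+1 : ℕ):ℝ) := by
    rw [uIcc_of_le (by push_cast; linarith)]; simp; intro h; omega
  have i1 : ∀ r : ℂ, IntervalIntegrable (fun x : ℝ => (x:ℂ) ^ r) volume (N:ℝ) ((N+1 : ℕ):ℝ) :=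
    fun r => intervalIntegral.intervalIntegrable_cpow (Or.inr hne)
  have hs1' : (1 : ℂ) - s ≠ 0 := sub_ne_zero.2 hs1.symm
  rw [h0, h1, intervalIntegral.integral_sub (i1 _) ((i1 _).const_mul _),
    intervalIntegral.integral_const_mul, integral_cpow, integral_cpow]
  · have e1 : -s + 1 = 1 - s := by ring
    have e2 : -s - 1 + 1 = -s := by ring
    rw [e1, e2]
    have hNc : (N:ℂ) ≠ 0 := by exact_mod_cast hN0.ne'
    have hN1c : ((N+1 : ℕ):ℂ) ≠ 0 := Nat.cast_ne_zero.2 (by omega)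
    have e3 : (N:ℂ) ^ (1 - s) = N * (N:ℂ) ^ (-s) := by
      rw [show (1 - s) = 1 + (-s) by ring, Complex.cpow_add _ _ hNc, Complex.cpow_one]
    have e4 : ((N+1:ℕ):ℂ) ^ (1 - s) = (N+1:ℕ) * ((N+1:ℕ):ℂ) ^ (-s) := by
      rw [show (1 - s) = 1 + (-s) by ring, Complex.cpow_add _ _ hN1c, Complex.cpow_one]
    simp only [Complex.ofReal_natCast]
    rw [e3, e4]
    push_cast
    field_simp
    ring
  · right; refine ⟨?_, hne⟩
    intro h; apply hs0; linear_combination -h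
  · right; refine ⟨?_, hne⟩
    intro h; apply hs1; linear_combination -h

lemma fz_zeta_gt (N : ℕ) (hN : 1 ≤ N) (s : ℂ) (hs : 1 < s.re) :
    riemannZeta s = ∑ n ∈ Finset.Icc 1 N, (n:ℂ) ^ (-s) + (N:ℂ) ^ (1 - s) / (s - 1) - s * fzI N s := by
  have hs1 : s ≠ 1 := by rintro rfl; simp at hs
  have hs1' : (1 : ℂ) - s ≠ 0 := sub_ne_zero.2 hs1.symm
  have hs1'' : s - 1 ≠ 0 := sub_ne_zero.2 hs1
  set R : ℕ → ℂ := fun N => ∑ n ∈ Finset.Icc 1 N, (n:ℂ) ^ (-s) + (N:ℂ) ^ (1 - s) / (s - 1) - s * fzI N s with hR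
  have hstep : ∀ M, 1 ≤ M → R (M + 1) = R M := by
    intro M hM
    have := fzI_step M hM s (by linarith) hs1
    simp only [hR]
    rw [Finset.sum_Icc_succ_top (by omega)]
    have e : ∀ z : ℂ, z / (s - 1) = - (z / (1 - s)) := by
      intro z; rw [← neg_sub 1 s, div_neg]
    rw [e, e]
    rw [sub_div] at this
    linear_combination this
  have hconst : ∀ k, R (N + k) = R N := by
    intro k
    induction k with
    | zero => rfl
    | succ k ih => rw [← add_assoc, hstep _ (by omega), ih]
  have hlim : Tendsto R atTop (nhds (riemannZeta s)) := by
    have l1 : Tendsto (fun N : ℕ => ∑ n ∈ Finset.Icc 1 N, (n:ℂ) ^ (-s)) atTop (nhds (riemannZeta s)) := by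
      have hsum : Summable (fun n : ℕ => 1 / ((n:ℂ) + 1) ^ s) := by
        have := (summable_nat_add_iff 1).2 (Complex.summable_one_div_nat_cpow.2 hs)
        simpa using this
      have := hsum.hasSum.tendsto_sum_nat
      rw [← zeta_eq_tsum_one_div_nat_add_one_cpow hs] at this
      refine this.congr fun N => ?_
      rw [Finset.range_eq_Ico, ← Finset.Ico_add_one_right_eq_Icc]
      rw [Finset.sum_Ico_eq_sum_range, Finset.sum_Ico_eq_sum_range]
      refine Finset.sum_congr (by simp) fun n _ => ?_
      rw [Complex.cpow_neg]
      push_cast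
      rw [one_div]
      congr 2; ring
    have l2 : Tendsto (fun N : ℕ => (N:ℂ) ^ (1 - s) / (s - 1)) atTop (nhds 0) := by
      rw [← zero_div (s - 1)]
      refine Tendsto.div_const ?_ _
      rw [tendsto_zero_iff_norm_tendsto_zero]
      have := (tendsto_rpow_neg_atTop (y := s.re - 1) (by linarith)).comp tendsto_natCast_atTop_atTop
      refine this.congr' ?_
      filter_upwards [eventually_ge_atTop 1] with n hn
      have : (0:ℝ) < n := by exact_mod_cast hn
      rw [← Complex.ofReal_natCast, Complex.norm_cpow_eq_rpow_re_of_pos this]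
      simp
    have l3 : Tendsto (fun N : ℕ => s * fzI N s) atTop (nhds 0) := by
      rw [← mul_zero s]
      refine Tendsto.const_mul _ ?_
      have := (tendsto_rpow_neg_atTop (y := s.re) (by linarith)).comp tendsto_natCast_atTop_atTop
      have := this.div_const s.re
      rw [zero_div] at this
      refine squeeze_zero_norm' ?_ this
      filter_upwards [eventually_ge_atTop 1] with n hn
      exact fzI_norm n hn s (by linarith)
    simpa using (l1.add l2).sub l3
  have : Tendsto (fun k => R (k + N)) atTop (nhds (riemannZeta s)) :=
    hlim.comp (tendsto_add_atTop_nat N)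
  have h2 : Tendsto (fun k => R (k + N)) atTop (nhds (R N)) := by
    refine tendsto_const_nhds.congr fun k => ?_
    rw [add_comm, hconst]
  exact tendsto_nhds_unique this h2

lemma fzI_diff (N : ℕ) (hN : 1 ≤ N) (s : ℂ) (hs : 0 < s.re) : DifferentiableAt ℂ (fzI N) s := by
  have hN0 : (0:ℝ) < N := by exact_mod_cast hN
  set f : ℝ → ℂ := (Ioi (N:ℝ)).indicator (fun x => ((Int.fract x : ℝ) : ℂ)) with hf
  have hb : ∀ x, ‖f x‖ ≤ 1 := by
    intro x
    refine (norm_indicator_le_norm_self _ _).trans ?_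
    rw [Complex.norm_real, Real.norm_eq_abs, abs_of_nonneg (Int.fract_nonneg x)]
    exact (Int.fract_lt_one x).le
  have hm : Measurable f := (Complex.measurable_ofReal.comp measurable_fract).indicator measurableSet_Ioi
  have h1 : fzI N = fun s => mellin f (-s) := by
    ext s
    rw [fzI, mellin]
    have : ∀ x : ℝ, (x:ℂ) ^ (-s - 1) • f x = (Ioi (N:ℝ)).indicator (fun x => ((Int.fract x : ℝ) : ℂ) * (x:ℂ) ^ (-s - 1)) x := by
      intro x
      simp only [hf, indicator]
      split_ifs <;> simp [mul_comm]
    simp_rw [this]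
    rw [setIntegral_indicator measurableSet_Ioi]
    congr 2
    rw [inter_eq_right.2]
    exact Ioi_subset_Ioi hN0.le
  rw [h1]
  have h2 : DifferentiableAt ℂ (mellin f) (-s) := by
    apply mellin_differentiableAt_of_isBigO_rpow (a := 0) (b := -s.re - 1)
    · refine LocallyIntegrable.locallyIntegrableOn ?_ _
      refine (locallyIntegrable_const (1:ℂ)).mono hm.aestronglyMeasurable ?_
      refine ae_of_all _ fun x => by simpa using hb x
    · refine Asymptotics.IsBigO.of_bound 1 (Eventually.of_forall fun x => ?_)
      simpa using hb x
    · simpa using hs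
    · refine Asymptotics.IsBigO.of_bound 1 ?_
      have : Iio (N:ℝ) ∈ nhdsWithin (0:ℝ) (Ioi 0) := mem_nhdsWithin_of_mem_nhds (Iio_mem_nhds hN0)
      filter_upwards [this] with x hx
      have : f x = 0 := by
        simp only [hf]
        exact indicator_of_notMem (by simpa using (le_of_lt hx)) _
      rw [this]; simp
    · simp
  have h3 : DifferentiableAt ℂ (fun z : ℂ => -z) s := differentiableAt_id.neg
  exact DifferentiableAt.comp (g := mellin f) s h2 h3

lemma fz_zeta1 (N : ℕ) (hN : 1 ≤ N) (s : ℂ) (hs : 0 < s.re) :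
    riemannZeta₁ s = (s - 1) * ∑ n ∈ Finset.Icc 1 N, (n:ℂ) ^ (-s) + (N:ℂ) ^ (1 - s)
      - (s - 1) * s * fzI N s := by
  have hNc : (N:ℂ) ≠ 0 := Nat.cast_ne_zero.2 (by omega)
  have hopen : IsOpen {s : ℂ | 0 < s.re} := isOpen_lt continuous_const Complex.continuous_re
  have hpre : IsPreconnected {s : ℂ | 0 < s.re} := (convex_halfSpace_re_gt 0).isPreconnected
  have hA : AnalyticOnNhd ℂ riemannZeta₁ {s : ℂ | 0 < s.re} :=
    differentiable_riemannZeta₁.differentiableOn.analyticOnNhd hopen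
  have hB : AnalyticOnNhd ℂ (fun s : ℂ => (s - 1) * ∑ n ∈ Finset.Icc 1 N, (n:ℂ) ^ (-s) + (N:ℂ) ^ (1 - s)
      - (s - 1) * s * fzI N s) {s : ℂ | 0 < s.re} := by
    refine DifferentiableOn.analyticOnNhd (fun z hz => DifferentiableAt.differentiableWithinAt ?_) hopen
    have hsum : DifferentiableAt ℂ (fun s : ℂ => ∑ n ∈ Finset.Icc 1 N, (n:ℂ) ^ (-s)) z := by
      refine DifferentiableAt.fun_sum fun n hn => ?_
      have hn0 : (n:ℂ) ≠ 0 := by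
        have := (Finset.mem_Icc.1 hn).1
        exact Nat.cast_ne_zero.2 (by omega)
      exact (differentiableAt_id.neg).const_cpow (Or.inl hn0)
    have h2 : DifferentiableAt ℂ (fun s : ℂ => (N:ℂ) ^ (1 - s)) z :=
      ((differentiableAt_const _).sub differentiableAt_id).const_cpow (Or.inl hNc)
    have h3 := fzI_diff N hN z hz
    have h4 : DifferentiableAt ℂ (fun s : ℂ => s - 1) z := by fun_prop
    exact ((h4.mul hsum).add h2).sub ((h4.mul differentiableAt_id).mul h3)
  refine hA.eqOn_of_preconnected_of_eventuallyEq hB hpre (z₀ := 2) (by simp) ?_ hs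
  have : {s : ℂ | 1 < s.re} ∈ nhds (2:ℂ) :=
    (isOpen_lt continuous_const Complex.continuous_re).mem_nhds (by simp)
  filter_upwards [this] with z hz
  have hz : 1 < z.re := hz
  have hz1 : z ≠ 1 := by rintro rfl; simp at hz
  have hz1' : z - 1 ≠ 0 := sub_ne_zero.2 hz1
  have e := riemannZeta_eq_inv_sub_mul hz1
  rw [fz_zeta_gt N hN z hz] at e
  have e2 : riemannZeta₁ z = (z - 1) * ((z - 1)⁻¹ * riemannZeta₁ z) := by field_simp
  rw [e2, ← e]
  field_simp

lemma fz_zeta (N : ℕ) (hN : 1 ≤ N) (s : ℂ) (hs : 0 < s.re) (hs1 : s ≠ 1) :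
    riemannZeta s = ∑ n ∈ Finset.Icc 1 N, (n:ℂ) ^ (-s) + (N:ℂ) ^ (1 - s) / (s - 1) - s * fzI N s := by
  have hz1' : s - 1 ≠ 0 := sub_ne_zero.2 hs1
  rw [riemannZeta_eq_inv_sub_mul hs1, fz_zeta1 N hN s hs]
  field_simp

/-- The function whose Fourier transform is `fzI` on the critical line. -/
noncomputable def fzh (N : ℕ) (u : ℝ) : ℂ :=
  (Ioi (Real.log N)).indicator (fun u => ((Real.exp (-(1/2) * u) * Int.fract (Real.exp u) : ℝ) : ℂ)) u

lemma fzI_fourier (N : ℕ) (hN : 1 ≤ N) (t : ℝ) :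
    fzI N (1/2 + t * I) = ∫ u, fzh N u * Complex.exp (-(u * t) * I) := by
  have hN0 : (0:ℝ) < N := by exact_mod_cast hN
  set f : ℝ → ℂ := (Ioi (N:ℝ)).indicator (fun x => ((Int.fract x : ℝ) : ℂ)) with hf
  have h1 : fzI N (1/2 + t * I) = mellin f (-(1/2 + t * I)) := by
    rw [fzI, mellin]
    have : ∀ x : ℝ, (x:ℂ) ^ (-(1/2 + t * I) - 1) • f x = (Ioi (N:ℝ)).indicator (fun x => ((Int.fract x : ℝ) : ℂ) * (x:ℂ) ^ (-(1/2 + t * I) - 1)) x := by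
      intro x
      simp only [hf, indicator]
      split_ifs <;> simp [mul_comm]
    simp_rw [this]
    rw [setIntegral_indicator measurableSet_Ioi]
    congr 2
    rw [inter_eq_right.2]
    exact Ioi_subset_Ioi hN0.le
  rw [h1, mellin_eq_fourier, Real.fourier_real_eq_integral_exp_smul, ← integral_neg_eq_self]
  refine integral_congr_ae (ae_of_all _ fun u => ?_)
  simp only [fzh, hf, indicator, mem_Ioi, neg_neg]
  have : (N:ℝ) < Real.exp u ↔ Real.log N < u := (Real.log_lt_iff_lt_exp hN0).symm
  simp only [this]
  split_ifs
  · have e : ((-2 * π * -u * ((-(1/2 + (t:ℂ) * I)).im / (2 * π)) : ℝ) : ℂ) * I = -(u * t) * I := by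
      have : (-2 * π * -u * ((-(1/2 + (t:ℂ) * I)).im / (2 * π)) : ℝ) = - (u * t) := by
        simp; field_simp
      rw [this]; push_cast; ring
    rw [e]
    simp only [smul_eq_mul, Complex.real_smul]
    rw [mul_comm]
    congr 1
    push_cast
    congr 2
    simp
  · simp

lemma fzh_norm (N : ℕ) (u : ℝ) : ‖fzh N u‖ ≤ (Ioi (Real.log N)).indicator (fun u => Real.exp (-(1/2) * u)) u := by
  unfold fzh indicator
  split_ifs
  · rw [Complex.norm_real, Real.norm_eq_abs, abs_mul, abs_of_pos (Real.exp_pos _), abs_of_nonneg (Int.fract_nonneg _)]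
    exact mul_le_of_le_one_right (Real.exp_pos _).le (Int.fract_lt_one _).le
  · simp

lemma fzh_meas (N : ℕ) : Measurable (fzh N) := by
  unfold fzh
  refine Measurable.indicator ?_ measurableSet_Ioi
  refine Complex.measurable_ofReal.comp (Measurable.mul (by fun_prop) (measurable_fract.comp (by fun_prop)))

lemma fzh_integrable (N : ℕ) : Integrable (fzh N) := by
  refine Integrable.mono' (g := (Ioi (Real.log N)).indicator (fun u => Real.exp (-(1/2) * u))) ?_ (fzh_meas N).aestronglyMeasurable (ae_of_all _ (fzh_norm N))
  rw [integrable_indicator_iff measurableSet_Ioi]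
  exact integrableOn_exp_mul_Ioi (by norm_num) _

lemma fzh_sq_norm (N : ℕ) (u : ℝ) : ‖fzh N u‖ ^ 2 ≤ (Ioi (Real.log N)).indicator (fun u => Real.exp (-u)) u := by
  refine (pow_le_pow_left₀ (norm_nonneg _) (fzh_norm N u) 2).trans (le_of_eq ?_)
  unfold indicator
  split_ifs
  · rw [← Real.exp_nat_mul]; congr 1; push_cast; ring
  · simp

lemma fzh_sq_int (N : ℕ) : Integrable ((Ioi (Real.log N)).indicator (fun u => Real.exp (-u))) := by
  rw [integrable_indicator_iff measurableSet_Ioi]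
  exact integrableOn_exp_neg_Ioi _

lemma fzh_memLp (N : ℕ) : MemLp (fzh N) 2 := by
  rw [memLp_two_iff_integrable_sq_norm (fzh_meas N).aestronglyMeasurable]
  refine Integrable.mono' (fzh_sq_int N) ((fzh_meas N).norm.pow_const 2).aestronglyMeasurable (ae_of_all _ fun u => ?_)
  rw [Real.norm_eq_abs, abs_of_nonneg (by positivity)]
  exact fzh_sq_norm N u

lemma fzI_mv (N : ℕ) (hN : 1 ≤ N) (H : ℝ) (hH : 0 ≤ H) :
    ∫ t in (-H)..H, ‖fzI N (1/2 + t * I)‖ ^ 2 ≤ 2 * π / N := by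
  have hN0 : (0:ℝ) < N := by exact_mod_cast hN
  simp_rw [fzI_fourier N hN]
  refine (fz_plancherel' (fzh N) (fzh_integrable N) (fzh_memLp N) H hH).trans ?_
  have : ∫ x, ‖fzh N x‖ ^ 2 ≤ 1 / N := by
    calc ∫ x, ‖fzh N x‖ ^ 2 ≤ ∫ x, (Ioi (Real.log N)).indicator (fun u => Real.exp (-u)) x := by
          refine integral_mono_of_nonneg (ae_of_all _ fun u => by positivity) (fzh_sq_int N) (ae_of_all _ (fzh_sq_norm N))
      _ = 1 / N := by
          rw [integral_indicator measurableSet_Ioi, integral_exp_neg_Ioi, Real.exp_neg, Real.exp_log hN0, one_div]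
  calc 2 * π * ∫ x, ‖fzh N x‖ ^ 2 ≤ 2 * π * (1 / N) := by gcongr
    _ = _ := by ring

lemma fz_natCast_cpow (n : ℕ) (hn : 1 ≤ n) (a t : ℝ) :
    (n:ℂ) ^ (-((a:ℂ) + t * I)) = (((n:ℝ) ^ (-a) : ℝ) : ℂ) * Complex.exp (-(Real.log n) * I * t) := by
  have hn0 : (0:ℝ) < n := by exact_mod_cast hn
  have hnc : (n:ℂ) ≠ 0 := Nat.cast_ne_zero.2 (by omega)
  rw [neg_add, Complex.cpow_add _ _ hnc, Complex.ofReal_cpow hn0.le]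
  push_cast
  congr 1
  rw [Complex.cpow_def_of_ne_zero hnc, ← Complex.ofReal_natCast n, ← Complex.ofReal_log hn0.le]
  congr 1; ring

lemma fz_half_sq (n : ℕ) (hn : 1 ≤ n) : (((n:ℝ) ^ (-(1/2:ℝ))) : ℝ)^2 = 1 / n := by
  have hn0 : (0:ℝ) < n := by exact_mod_cast hn
  rw [← Real.rpow_natCast, ← Real.rpow_mul hn0.le]
  norm_num
  rw [Real.rpow_neg_one]

lemma fz_zeta_line_cont : Continuous (fun t : ℝ => riemannZeta (1/2 + t * I)) := by
  rw [continuous_iff_continuousAt]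
  intro t
  have h : (1/2 + t * I : ℂ) ≠ 1 := by
    intro h; have := congrArg Complex.re h; norm_num at this
  exact ContinuousAt.comp (f := fun t : ℝ => (1/2 + t * I : ℂ)) (differentiableAt_riemannZeta h).continuousAt (by fun_prop)

lemma fzI_line_cont (N : ℕ) (hN : 1 ≤ N) : Continuous (fun t : ℝ => fzI N (1/2 + t * I)) := by
  rw [continuous_iff_continuousAt]
  intro t
  exact ContinuousAt.comp (f := fun t : ℝ => (1/2 + t * I : ℂ)) (fzI_diff N hN _ (by norm_num)).continuousAt (by fun_prop)

lemma fz_zeta_mv (H : ℝ) (hH : 2 ≤ H) :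
    ∫ t in (-H)..H, ‖riemannZeta (1/2 + t * I)‖ ^ 2 ≤ 300 * H * (1 + Real.log H) ^ 2 := by
  set N := ⌊H⌋₊ with hNdef
  have hN : 1 ≤ N := Nat.le_floor (by push_cast; linarith)
  have hN0 : (0:ℝ) < N := by exact_mod_cast hN
  have hNH : (N:ℝ) ≤ H := Nat.floor_le (by linarith)
  have hHN : H ≤ 2 * N := by
    have := (Nat.lt_floor_add_one H).le
    have h1 : (1:ℝ) ≤ N := by exact_mod_cast hN
    linarith
  have hlog : Real.log N ≤ Real.log H := Real.log_le_log hN0 hNH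
  have hlog0 : 0 ≤ Real.log N := Real.log_natCast_nonneg N
  set A : ℝ → ℂ := fun t => ∑ n ∈ Finset.Icc 1 N, (((n:ℝ) ^ (-(1/2:ℝ)) : ℝ) : ℂ) * Complex.exp (-(Real.log n) * I * t) with hA
  have hAc : Continuous A := by
    simp only [hA]; fun_prop
  have key : ∀ t ∈ Icc (-H) H, ‖riemannZeta (1/2 + t * I)‖ ^ 2 ≤ 3 * ‖A t‖ ^ 2 + 12 * N * (1 + t^2)⁻¹ + 6 * H^2 * ‖fzI N (1/2 + t*I)‖^2 := by
    intro t ht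
    have hs1 : (1/2 + t * I : ℂ) ≠ 1 := by
      intro h; have := congrArg Complex.re h; norm_num at this
    have hsA : ∑ n ∈ Finset.Icc 1 N, (n:ℂ) ^ (-(1/2 + t * I : ℂ)) = A t := by
      refine Finset.sum_congr rfl fun n hn => ?_
      rw [← fz_natCast_cpow n (Finset.mem_Icc.1 hn).1]
      push_cast; rfl
    have hsq : ∀ t : ℝ, ∀ a : ℝ, ‖(a + t * I : ℂ)‖^2 = a^2 + t^2 := by
      intro t a
      rw [← Complex.normSq_eq_norm_sq, Complex.normSq_add_mul_I]
    have hB : ‖(N:ℂ) ^ (1 - (1/2 + t * I : ℂ)) / ((1/2 + t * I : ℂ) - 1)‖ ^ 2 ≤ 4 * N * (1 + t^2)⁻¹ := by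
      rw [norm_div, div_pow]
      have e1 : ‖(N:ℂ) ^ (1 - (1/2 + t * I : ℂ))‖ ^ 2 = N := by
        rw [← Complex.ofReal_natCast, Complex.norm_cpow_eq_rpow_re_of_pos hN0, ← Real.rpow_natCast, ← Real.rpow_mul hN0.le]
        norm_num
      have e2 : ‖(1/2 + t * I : ℂ) - 1‖ ^ 2 = 1/4 + t^2 := by
        have := hsq t (-1/2)
        rw [show (1/2 + t * I : ℂ) - 1 = ((-1/2 : ℝ) + t * I : ℂ) by push_cast; ring, this]; ring
      rw [e1, e2, div_eq_mul_inv]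
      have : (1/4 + t^2)⁻¹ ≤ 4 * (1 + t^2)⁻¹ := by
        rw [inv_le_iff_one_le_mul₀ (by positivity)]
        have : 4 * (1 + t^2)⁻¹ * (1/4 + t^2) = (1 + 4 * t^2) / (1 + t^2) := by field_simp
        rw [this, le_div_iff₀ (by positivity)]
        nlinarith [sq_nonneg t]
      nlinarith
    have hD : ‖(1/2 + t * I : ℂ) * fzI N (1/2 + t * I)‖ ^ 2 ≤ 2 * H^2 * ‖fzI N (1/2 + t*I)‖^2 := by
      rw [norm_mul, mul_pow]
      gcongr
      have := hsq t (1/2)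
      rw [show (1/2 + t * I : ℂ) = ((1/2 : ℝ) + t * I : ℂ) by push_cast; ring, this]
      have : t^2 ≤ H^2 := sq_le_sq' ht.1 ht.2
      nlinarith
    rw [fz_zeta N hN _ (by norm_num) hs1, hsA]
    set b := (N:ℂ) ^ (1 - (1/2 + t * I : ℂ)) / ((1/2 + t * I : ℂ) - 1)
    set d := (1/2 + t * I : ℂ) * fzI N (1/2 + t * I)
    have h3 : ‖A t + b - d‖ ≤ ‖A t‖ + ‖b‖ + ‖d‖ :=
      (norm_sub_le _ _).trans (by gcongr; exact norm_add_le _ _)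
    have h4 : ‖A t + b - d‖^2 ≤ (‖A t‖ + ‖b‖ + ‖d‖)^2 := pow_le_pow_left₀ (norm_nonneg _) h3 2
    nlinarith [sq_nonneg (‖A t‖ - ‖b‖), sq_nonneg (‖A t‖ - ‖d‖), sq_nonneg (‖b‖ - ‖d‖)]
  have i0 := fz_zeta_line_cont
  have i2 := fzI_line_cont N hN
  have i1 : Continuous (fun t : ℝ => (1 + t^2)⁻¹) := by
    refine Continuous.inv₀ (by fun_prop) fun t => by positivity
  have I1 : ∫ t in (-H)..H, ‖A t‖^2 ≤ (2 * H + 4 * N * (1 + Real.log N)) * (1 + Real.log N) := by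
    refine (fz_mv _ N H (by linarith)).trans ?_
    gcongr
    refine le_trans (le_of_eq ?_) (fz_harm N)
    refine Finset.sum_congr rfl fun n hn => ?_
    rw [Complex.norm_real, Real.norm_eq_abs, sq_abs, fz_half_sq n (Finset.mem_Icc.1 hn).1]
  have I2 : ∫ t in (-H)..H, (1 + t^2)⁻¹ ≤ 4 := by
    rw [integral_inv_one_add_sq]
    have := Real.arctan_lt_pi_div_two H
    have := Real.neg_pi_div_two_lt_arctan (-H)
    have := Real.pi_le_four
    linarith
  have I3 := fzI_mv N hN H (by linarith)
  have hle : -H ≤ H := by linarith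
  have step : ∫ t in (-H)..H, ‖riemannZeta (1/2 + t * I)‖ ^ 2 ≤
      ∫ t in (-H)..H, (3 * ‖A t‖ ^ 2 + 12 * N * (1 + t^2)⁻¹ + 6 * H^2 * ‖fzI N (1/2 + t*I)‖^2) := by
    refine intervalIntegral.integral_mono_on hle ?_ ?_ key
    · exact Continuous.intervalIntegrable (by fun_prop) _ _
    · exact Continuous.intervalIntegrable (by fun_prop) _ _
  rw [intervalIntegral.integral_add, intervalIntegral.integral_add, intervalIntegral.integral_const_mul,
    intervalIntegral.integral_const_mul, intervalIntegral.integral_const_mul] at step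
  rotate_left
  · exact Continuous.intervalIntegrable (by fun_prop) _ _
  · exact Continuous.intervalIntegrable (by fun_prop) _ _
  · exact Continuous.intervalIntegrable (by fun_prop) _ _
  · exact Continuous.intervalIntegrable (by fun_prop) _ _
  have hp := Real.pi_le_four
  have J3 : 6 * H^2 * ∫ t in (-H)..H, ‖fzI N (1/2 + t*I)‖^2 ≤ 96 * H := by
    calc _ ≤ 6 * H^2 * (2 * π / N) := by gcongr
      _ ≤ 6 * H^2 * (2 * 4 / (H / 2)) := by
          gcongr; linarith
      _ = 96 * H := by field_simp; ring
  have J2 : 12 * N * ∫ t in (-H)..H, (1 + t^2)⁻¹ ≤ 12 * H * 4 := by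
    have : (12:ℝ) * N * ∫ t in (-H)..H, (1 + t^2)⁻¹ ≤ 12 * N * 4 := by gcongr
    linarith
  have J1 : 3 * ∫ t in (-H)..H, ‖A t‖^2 ≤ 3 * (6 * H * (1 + Real.log H)^2) := by
    gcongr
    refine I1.trans ?_
    calc _ ≤ (2 * H * (1 + Real.log H) + 4 * H * (1 + Real.log H)) * (1 + Real.log H) := by
          have a1 : 2 * H ≤ 2 * H * (1 + Real.log H) := by nlinarith
          have a2 : 4 * N * (1 + Real.log N) ≤ 4 * H * (1 + Real.log H) := by gcongr
          have a3 : 1 + Real.log N ≤ 1 + Real.log H := by linarith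
          exact mul_le_mul (add_le_add a1 a2) a3 (by linarith) (by nlinarith)
      _ = _ := by ring
  have : (1:ℝ) ≤ (1 + Real.log H)^2 := by nlinarith
  nlinarith

lemma fz_tail (f : ℕ → ℂ) (hf : ∀ n, ‖f n‖ ≤ 1) (s : ℂ) (hs : 2 ≤ s.re) (X : ℕ) (hX : 1 ≤ X) :
    ‖LSeries f s - ∑ n ∈ Finset.Icc 1 X, f n * (n:ℂ) ^ (-s)‖ ≤ 1 / X := by
  have hsum : LSeriesSummable f s :=
    LSeriesSummable_of_bounded_of_one_lt_re (m := 1) (fun n _ => hf n) (by linarith)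
  have hnorm : ∀ n, ‖LSeries.term f s n‖ ≤ ((n:ℝ)^2)⁻¹ := by
    intro n
    rw [LSeries.norm_term_eq]
    split_ifs with h
    · positivity
    · rw [div_eq_mul_inv]
      have hn1 : (1:ℝ) ≤ n := by exact_mod_cast Nat.one_le_iff_ne_zero.2 h
      have h2 : (n:ℝ)^2 ≤ (n:ℝ)^s.re := by
        rw [← Real.rpow_two]
        exact Real.rpow_le_rpow_of_exponent_le hn1 hs
      refine (mul_le_of_le_one_left (by positivity) (hf n)).trans ?_
      gcongr
  have h1 : ∑ n ∈ Finset.Icc 1 X, f n * (n:ℂ) ^ (-s) = ∑ n ∈ Finset.range (X+1), LSeries.term f s n := by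
    rw [Finset.sum_range_succ', LSeries.term_zero, add_zero, ← Finset.Ico_add_one_right_eq_Icc, Finset.sum_Ico_eq_sum_range]
    refine Finset.sum_congr (by simp) fun n _ => ?_
    rw [LSeries.term_of_ne_zero (by omega), Complex.cpow_neg, div_eq_mul_inv, add_comm n 1]
  have h2 := hsum.sum_add_tsum_nat_add (X+1)
  have h3 : LSeries f s - ∑ n ∈ Finset.Icc 1 X, f n * (n:ℂ) ^ (-s) = ∑' n, LSeries.term f s (n + (X+1)) := by
    rw [h1, LSeries, ← h2]; ring
  rw [h3]
  have hb : ∀ m, ∑ n ∈ Finset.range m, (((n + (X+1) : ℕ):ℝ)^2)⁻¹ ≤ 1 / X := by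
    intro m
    have := sum_Ioc_inv_sq_le_sub (α := ℝ) (k := X) (n := X + m) (by omega) (by omega)
    have e : ∑ n ∈ Finset.range m, (((n + (X+1) : ℕ):ℝ)^2)⁻¹ = ∑ i ∈ Finset.Ioc X (X+m), ((i:ℝ)^2)⁻¹ := by
      rw [← Finset.Ico_add_one_add_one_eq_Ioc, Finset.sum_Ico_eq_sum_range]
      refine Finset.sum_congr (by congr 1; omega) fun n _ => ?_
      rw [add_comm n]
    rw [e, one_div]
    refine this.trans ?_
    have : (0:ℝ) ≤ ((X + m : ℕ):ℝ)⁻¹ := by positivity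
    linarith
  have hs2 : Summable (fun n : ℕ => (((n + (X+1) : ℕ):ℝ)^2)⁻¹) :=
    summable_of_sum_range_le (fun n => by positivity) hb
  exact (tsum_of_norm_bounded hs2.hasSum fun n => hnorm _).trans
    (Real.tsum_le_of_sum_range_le (fun n => by positivity) hb)

/-- The mollifier. -/
noncomputable def fzM (X : ℕ) (s : ℂ) : ℂ :=
  ∑ n ∈ Finset.Icc 1 X, ((ArithmeticFunction.moebius n : ℤ) : ℂ) * (n:ℂ) ^ (-s)

/-- The regularised mollified error. -/
noncomputable def fzF (X : ℕ) (s : ℂ) : ℂ := (riemannZeta₁ s * fzM X s - (s - 1)) / (s + 1)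

lemma fz_moeb (n : ℕ) : ‖((ArithmeticFunction.moebius n : ℤ) : ℂ)‖ ≤ 1 := by
  rw [Complex.norm_intCast]
  exact_mod_cast ArithmeticFunction.abs_moebius_le_one

lemma fz_two (X : ℕ) (hX : 1 ≤ X) (s : ℂ) (hs : 2 ≤ s.re) :
    ‖riemannZeta s * fzM X s - 1‖ ≤ 2 / X := by
  have hs1 : 1 < s.re := by linarith
  have hz : ‖riemannZeta s‖ ≤ 2 := by
    have := fz_tail (fun _ => 1) (fun _ => by simp) s hs 1 le_rfl
    have e : LSeries (fun _ => 1) s = riemannZeta s := LSeries_one_eq_riemannZeta hs1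
    rw [e] at this
    simp at this
    calc ‖riemannZeta s‖ = ‖(riemannZeta s - 1) + 1‖ := by congr 1; ring
      _ ≤ 1 + 1 := (norm_add_le _ _).trans (by simpa using this)
      _ = 2 := by norm_num
  have h1 := fz_tail (fun n => ((ArithmeticFunction.moebius n : ℤ) : ℂ)) fz_moeb s hs X hX
  have h2 := LSeries_one_mul_Lseries_moebius hs1
  rw [LSeries_one_eq_riemannZeta hs1] at h2
  rw [← h2, ← mul_sub, norm_mul, norm_sub_rev]
  calc _ ≤ 2 * (1 / (X:ℝ)) := by
        gcongr
        exact h1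
    _ = _ := by ring

lemma fzM_diff (X : ℕ) (s : ℂ) : DifferentiableAt ℂ (fzM X) s := by
  unfold fzM
  refine DifferentiableAt.fun_sum fun n hn => ?_
  have hn0 : (n:ℂ) ≠ 0 := by
    have := (Finset.mem_Icc.1 hn).1
    exact Nat.cast_ne_zero.2 (by omega)
  exact ((differentiableAt_id.neg).const_cpow (Or.inl hn0)).const_mul _

lemma fzF_diff (X : ℕ) (s : ℂ) (hs : 0 < s.re) : DifferentiableAt ℂ (fzF X) s := by
  unfold fzF
  have h : s + 1 ≠ 0 := by
    intro h; have := congrArg Complex.re h; simp at this; linarith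
  refine DifferentiableAt.fun_div ?_ (by fun_prop) h
  exact ((differentiable_riemannZeta₁ s).mul (fzM_diff X s)).sub (by fun_prop)

lemma fz_sub_le_add (s : ℂ) (hs : 0 ≤ s.re) : ‖s - 1‖ ≤ ‖s + 1‖ := by
  rw [← sq_le_sq₀ (norm_nonneg _) (norm_nonneg _), ← Complex.normSq_eq_norm_sq, ← Complex.normSq_eq_norm_sq,
    Complex.normSq_apply, Complex.normSq_apply]
  simp; nlinarith

lemma fzF_eq (X : ℕ) (s : ℂ) (hs : s ≠ 1) :
    fzF X s = (s - 1) / (s + 1) * (riemannZeta s * fzM X s - 1) := by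
  have h : s - 1 ≠ 0 := sub_ne_zero.2 hs
  rw [fzF, riemannZeta_eq_inv_sub_mul hs]
  have : riemannZeta₁ s * fzM X s - (s - 1) = (s-1) * ((s - 1)⁻¹ * riemannZeta₁ s * fzM X s - 1) := by
    field_simp
  rw [this]; ring

lemma fzF_le (X : ℕ) (s : ℂ) (hs0 : 0 ≤ s.re) (hs : s ≠ 1) :
    ‖fzF X s‖ ≤ ‖riemannZeta s * fzM X s - 1‖ := by
  have h1 : ‖(s - 1) / (s + 1)‖ ≤ 1 := by
    rw [norm_div]
    exact div_le_one_of_le₀ (fz_sub_le_add s hs0) (norm_nonneg _)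
  rw [fzF_eq X s hs, norm_mul]
  exact mul_le_of_le_one_left (norm_nonneg _) h1

lemma fzF_ge (X : ℕ) (s : ℂ) (hs : 3/2 ≤ |s.im|) :
    ‖riemannZeta s * fzM X s - 1‖ ≤ 3 * ‖fzF X s‖ := by
  have hs1 : s ≠ 1 := by rintro rfl; norm_num at hs
  have h3 : 3/2 ≤ ‖s - 1‖ := by
    have := Complex.abs_im_le_norm (s - 1)
    simp at this; linarith
  have h1 : ‖s + 1‖ ≤ 3 * ‖s - 1‖ := by
    calc ‖s + 1‖ = ‖(s - 1) + 2‖ := by congr 1; ring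
      _ ≤ ‖s - 1‖ + ‖(2:ℂ)‖ := norm_add_le _ _
      _ ≤ _ := by simp; linarith
  have h2 : 0 < ‖s + 1‖ := by
    have := Complex.abs_im_le_norm (s + 1)
    simp at this; linarith
  rw [fzF_eq X s hs1, norm_mul, norm_div, ← mul_assoc]
  refine le_mul_of_one_le_left (norm_nonneg _) ?_
  rw [← mul_div_assoc, le_div_iff₀ h2]; linarith

lemma fzM_le (X : ℕ) (s : ℂ) (hs : 0 ≤ s.re) : ‖fzM X s‖ ≤ X := by
  unfold fzM
  refine (norm_sum_le _ _).trans ?_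
  calc _ ≤ ∑ n ∈ Finset.Icc 1 X, (1:ℝ) := by
        refine Finset.sum_le_sum fun n hn => ?_
        have hn1 : 1 ≤ n := (Finset.mem_Icc.1 hn).1
        have hn0 : (0:ℝ) < n := by exact_mod_cast hn1
        rw [norm_mul, ← Complex.ofReal_natCast, Complex.norm_cpow_eq_rpow_re_of_pos hn0]
        refine mul_le_one₀ (fz_moeb n) (by positivity) ?_
        exact Real.rpow_le_one_of_one_le_of_nonpos (by exact_mod_cast hn1) (by simpa using hs)
    _ = X := by simp

lemma fz_zeta1_growth (s : ℂ) (hs : 1/2 ≤ s.re) : ‖riemannZeta₁ s‖ ≤ ‖s + 1‖ * (2 + 2 * ‖s‖) := by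
  have h := fz_zeta1 1 le_rfl s (by linarith)
  simp only [Finset.Icc_self, Finset.sum_singleton, Nat.cast_one, Complex.one_cpow, mul_one] at h
  have hI : ‖fzI 1 s‖ ≤ 2 := by
    refine (fzI_norm 1 le_rfl s (by linarith)).trans ?_
    rw [Nat.cast_one, Real.one_rpow, div_le_iff₀ (by linarith)]; linarith
  rw [h]
  have h1 := fz_sub_le_add s (by linarith)
  have h2 : 1 ≤ ‖s + 1‖ := by
    have := Complex.abs_re_le_norm (s + 1)
    have h3 := le_abs_self (s+1).re
    simp at this h3; linarith
  calc ‖s - 1 + 1 - (s - 1) * s * fzI 1 s‖ ≤ ‖s - 1‖ + 1 + ‖s - 1‖ * ‖s‖ * ‖fzI 1 s‖ := by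
        refine (norm_sub_le _ _).trans ?_
        rw [norm_mul, norm_mul]
        gcongr
        exact (norm_add_le _ _).trans (by simp)
    _ ≤ ‖s + 1‖ + ‖s + 1‖ + ‖s + 1‖ * ‖s‖ * 2 := by gcongr
    _ = _ := by ring

lemma fzF_growth (X : ℕ) (s : ℂ) (hs : 1/2 ≤ s.re) : ‖fzF X s‖ ≤ (2 + 2 * ‖s‖) * X + 1 := by
  have h1 := fz_sub_le_add s (by linarith)
  have h2 : 1 ≤ ‖s + 1‖ := by
    have := Complex.abs_re_le_norm (s + 1)
    have h3 := le_abs_self (s+1).re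
    simp at this h3; linarith
  rw [fzF, norm_div, div_le_iff₀ (by linarith)]
  calc _ ≤ ‖riemannZeta₁ s * fzM X s‖ + ‖s - 1‖ := norm_sub_le _ _
    _ ≤ (‖s + 1‖ * (2 + 2 * ‖s‖)) * X + ‖s + 1‖ := by
        rw [norm_mul]
        gcongr
        · exact fz_zeta1_growth s hs
        · exact fzM_le X s (by linarith)
    _ = _ := by ring

lemma fzM_mv (X : ℕ) (H : ℝ) (hX : 1 ≤ X) (hXH : (X:ℝ) ≤ H) :
    ∫ t in (-H)..H, ‖fzM X (1/2 + t * I)‖ ^ 2 ≤ 6 * H * (1 + Real.log H) ^ 2 := by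
  have hX0 : (0:ℝ) < X := by exact_mod_cast hX
  have e : ∀ t : ℝ, fzM X (1/2 + t * I) = ∑ n ∈ Finset.Icc 1 X, (((ArithmeticFunction.moebius n : ℤ) : ℂ) * (((n:ℝ) ^ (-(1/2:ℝ)) : ℝ) : ℂ)) * Complex.exp (-(Real.log n) * I * t) := by
    intro t
    refine Finset.sum_congr rfl fun n hn => ?_
    rw [mul_assoc, ← fz_natCast_cpow n (Finset.mem_Icc.1 hn).1]
    push_cast; rfl
  simp_rw [e]
  have hlog : Real.log X ≤ Real.log H := Real.log_le_log hX0 hXH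
  have hlog0 : 0 ≤ Real.log X := Real.log_natCast_nonneg X
  refine (fz_mv _ X H (by linarith)).trans ?_
  have hs : ∑ n ∈ Finset.Icc 1 X, ‖((ArithmeticFunction.moebius n : ℤ) : ℂ) * (((n:ℝ) ^ (-(1/2:ℝ)) : ℝ) : ℂ)‖ ^ 2 ≤ 1 + Real.log X := by
    refine le_trans (Finset.sum_le_sum fun n hn => ?_) (fz_harm X)
    rw [norm_mul, mul_pow, Complex.norm_real, Real.norm_eq_abs, sq_abs, fz_half_sq n (Finset.mem_Icc.1 hn).1]
    exact mul_le_of_le_one_left (by positivity) (pow_le_one₀ (norm_nonneg _) (fz_moeb n))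
  calc _ ≤ (2 * H * (1 + Real.log H) + 4 * H * (1 + Real.log H)) * (1 + Real.log H) := by
        have a1 : 2 * H ≤ 2 * H * (1 + Real.log H) := by nlinarith
        have hH0 : 0 < H := by linarith
        have a2 : 4 * X * (1 + Real.log X) ≤ 4 * H * (1 + Real.log H) := by gcongr
        exact mul_le_mul (add_le_add a1 a2) (hs.trans (by linarith)) (by positivity) (by nlinarith)
    _ = _ := by ring

lemma fzF_line_cont (X : ℕ) (σ : ℝ) (hσ : 0 < σ) : Continuous (fun t : ℝ => fzF X (σ + t * I)) := by
  rw [continuous_iff_continuousAt]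
  intro t
  exact ContinuousAt.comp (f := fun t : ℝ => (σ + t * I : ℂ)) (fzF_diff X _ (by simpa using hσ)).continuousAt (by fun_prop)

lemma fzF_half (X : ℕ) (H : ℝ) (hX : 1 ≤ X) (hXH : (X:ℝ) ≤ H) (hH : 2 ≤ H) :
    ∫ t in (-H)..H, ‖fzF X (1/2 + t * I)‖ ≤ 155 * H * (1 + Real.log H) ^ 2 := by
  have hM : Continuous (fun t : ℝ => fzM X (1/2 + t * I)) := by
    rw [continuous_iff_continuousAt]
    intro t
    exact ContinuousAt.comp (f := fun t : ℝ => (1/2 + t * I : ℂ)) (fzM_diff X _).continuousAt (by fun_prop)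
  have hZ := fz_zeta_line_cont
  have hF : Continuous (fun t : ℝ => fzF X (1/2 + t * I)) := by
    have := fzF_line_cont X (1/2) (by norm_num)
    push_cast at this; exact this
  have hle : -H ≤ H := by linarith
  have key : ∫ t in (-H)..H, ‖fzF X (1/2 + t * I)‖ ≤ ∫ t in (-H)..H, (1/2 * ‖riemannZeta (1/2 + t * I)‖^2 + 1/2 * ‖fzM X (1/2 + t * I)‖^2 + 1) := by
    refine intervalIntegral.integral_mono_on hle (Continuous.intervalIntegrable (by fun_prop) _ _) (Continuous.intervalIntegrable (by fun_prop) _ _) fun t _ => ?_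
    have hs1 : (1/2 + t * I : ℂ) ≠ 1 := by
      intro h; have := congrArg Complex.re h; norm_num at this
    refine (fzF_le X _ (by norm_num) hs1).trans ((norm_sub_le _ _).trans ?_)
    rw [norm_mul, norm_one]
    nlinarith [sq_nonneg (‖riemannZeta (1/2 + t * I)‖ - ‖fzM X (1/2 + t * I)‖)]
  rw [intervalIntegral.integral_add, intervalIntegral.integral_add, intervalIntegral.integral_const_mul,
    intervalIntegral.integral_const_mul, intervalIntegral.integral_const] at key
  rotate_left
  · exact Continuous.intervalIntegrable (by fun_prop) _ _
  · exact Continuous.intervalIntegrable (by fun_prop) _ _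
  · exact Continuous.intervalIntegrable (by fun_prop) _ _
  · exact Continuous.intervalIntegrable (by fun_prop) _ _
  have h1 := fz_zeta_mv H hH
  have h2 := fzM_mv X H hX hXH
  have : 0 ≤ Real.log H := Real.log_nonneg (by linarith)
  have : (1:ℝ) ≤ (1 + Real.log H)^2 := by nlinarith
  simp at key
  nlinarith

lemma fz_param_diff (F : ℂ → ℂ) (hF : ∀ s : ℂ, 0 < s.re → DifferentiableAt ℂ F s) (φ : ℝ → ℂ)
    (hφ : Measurable φ) (hφ1 : ∀ t, ‖φ t‖ ≤ 1) (a b : ℝ) (z₀ : ℂ) (hz₀ : 0 < z₀.re) :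
    DifferentiableAt ℂ (fun z => ∫ t in a..b, F (z + t * I) * φ t) z₀ := by
  have hopen : IsOpen {s : ℂ | 0 < s.re} := isOpen_lt continuous_const Complex.continuous_re
  have hFd : DifferentiableOn ℂ F {s : ℂ | 0 < s.re} := fun s hs => (hF s hs).differentiableWithinAt
  have hF' : ContinuousOn (deriv F) {s : ℂ | 0 < s.re} := (hFd.deriv hopen).continuousOn
  have hFc : ContinuousOn F {s : ℂ | 0 < s.re} := hFd.continuousOn
  have hline : ∀ z : ℂ, 0 < z.re → ∀ G : ℂ → ℂ, ContinuousOn G {s : ℂ | 0 < s.re} → Continuous (fun t : ℝ => G (z + t * I)) := by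
    intro z hz G hG
    refine hG.comp_continuous (by fun_prop) fun t => ?_
    simpa using hz
  set r := z₀.re / 2 with hr
  have hr0 : 0 < r := by positivity
  have hpos : ∀ z ∈ Metric.closedBall z₀ r, 0 < z.re := by
    intro z hz
    have h1 := Complex.abs_re_le_norm (z - z₀)
    rw [Metric.mem_closedBall, dist_eq_norm] at hz
    have h2 := (abs_le.1 (h1.trans hz)).1
    simp at h2; linarith
  have hcomp : IsCompact ((fun p : ℂ × ℝ => p.1 + p.2 * I) '' (Metric.closedBall z₀ r ×ˢ uIcc a b)) :=
    ((isCompact_closedBall z₀ r).prod isCompact_uIcc).image (by fun_prop)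
  have hsub : ((fun p : ℂ × ℝ => p.1 + p.2 * I) '' (Metric.closedBall z₀ r ×ˢ uIcc a b)) ⊆ {s : ℂ | 0 < s.re} := by
    rintro _ ⟨⟨z, t⟩, ⟨hz, _⟩, rfl⟩
    simpa using hpos z hz
  obtain ⟨C, hC⟩ := hcomp.exists_bound_of_continuousOn (hF'.mono hsub)
  have := intervalIntegral.hasDerivAt_integral_of_dominated_loc_of_deriv_le (μ := volume) (a := a) (b := b)
    (F := fun z t => F (z + t * I) * φ t) (F' := fun z t => deriv F (z + t * I) * φ t) (x₀ := z₀)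
    (s := Metric.closedBall z₀ r) (bound := fun _ => C) (Metric.closedBall_mem_nhds _ hr0) ?_ ?_ ?_ ?_ ?_ ?_
  · exact this.2.differentiableAt
  · filter_upwards [Metric.closedBall_mem_nhds z₀ hr0] with z hz
    exact (((hline z (hpos z hz) F hFc).measurable).mul hφ).aestronglyMeasurable
  · have i1 : IntervalIntegrable (fun t : ℝ => F (z₀ + t * I)) volume a b :=
      (hline z₀ hz₀ F hFc).intervalIntegrable _ _
    refine i1.mono_fun (((hline z₀ hz₀ F hFc).measurable).mul hφ).aestronglyMeasurable (ae_of_all _ fun t => ?_)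
    simp only [norm_mul]
    exact mul_le_of_le_one_right (norm_nonneg _) (hφ1 t)
  · exact (((hline z₀ hz₀ _ hF').measurable).mul hφ).aestronglyMeasurable
  · refine ae_of_all _ fun t ht z hz => ?_
    rw [norm_mul]
    exact (mul_le_of_le_one_right (norm_nonneg _) (hφ1 t)).trans (hC _ ⟨(z, t), ⟨hz, uIoc_subset_uIcc ht⟩, rfl⟩)
  · exact intervalIntegrable_const
  · refine ae_of_all _ fun t ht z hz => ?_
    refine HasDerivAt.mul_const ?_ _
    have hd : HasDerivAt F (deriv F (z + t * I)) (z + t * I) :=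
      (hF _ (by simpa using hpos z hz)).hasDerivAt
    exact hd.comp_add_const z (t * I : ℂ)

lemma fz_exp_cube (y : ℝ) : (1 + |y|) ^ 3 * Real.exp (-y^2) ≤ 8 * Real.exp 1 := by
  have h := Real.pow_div_factorial_le_exp (1 + y^2) (by positivity) 2
  simp at h
  rw [Real.exp_neg, ← div_eq_mul_inv, div_le_iff₀ (Real.exp_pos _), mul_assoc, ← Real.exp_add]
  have h1 : 0 ≤ |y| := abs_nonneg y
  have h2 : y^2 = |y|^2 := (sq_abs y).symm
  rw [h2] at h ⊢
  set a := |y|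
  nlinarith [sq_nonneg (a - 1), sq_nonneg (a^2 - 1), pow_nonneg h1 2, pow_nonneg h1 3, sq_nonneg (a^2 - a)]

lemma fz_exp_norm (z : ℂ) (σ : ℝ) (hσ : 1/2 ≤ σ) (hσ2 : σ ≤ 2) (hz : 1/2 ≤ z.re) (hz2 : z.re ≤ 2) :
    ‖Complex.exp ((z - σ)^2)‖ ≤ Real.exp (9/4) * Real.exp (-z.im^2) := by
  rw [Complex.norm_exp, ← Real.exp_add]
  apply Real.exp_le_exp.2
  have : ((z - σ)^2).re = (z.re - σ)^2 - z.im^2 := by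
    rw [sq, Complex.mul_re]; simp; ring
  rw [this]
  nlinarith

lemma fz_left_edge (X : ℕ) (T : ℝ) (hX : 1 ≤ X) (hXT : (X:ℝ) ≤ T) (hT : 2 ≤ T) (y : ℝ) :
    ∫ t in (-T)..T, ‖fzF X (1/2 + (y + t : ℝ) * I)‖ ≤ 155 * T * (1 + Real.log T)^2 * (1 + |y|)^3 := by
  have hF : Continuous (fun t : ℝ => fzF X (1/2 + t * I)) := by
    have := fzF_line_cont X (1/2) (by norm_num)
    push_cast at this; exact this
  have hy := abs_nonneg y
  have e : ∫ t in (-T)..T, ‖fzF X (1/2 + (y + t : ℝ) * I)‖ = ∫ t in (y + -T)..(y + T), ‖fzF X (1/2 + t * I)‖ :=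
    intervalIntegral.integral_comp_add_left (fun t : ℝ => ‖fzF X (1/2 + t * I)‖) y
  rw [e]
  have h1 : ∫ t in (y + -T)..(y + T), ‖fzF X (1/2 + t * I)‖ ≤ ∫ t in (-(T + |y|))..(T + |y|), ‖fzF X (1/2 + t * I)‖ := by
    refine intervalIntegral.integral_mono_interval ?_ ?_ ?_ (ae_of_all _ fun t => norm_nonneg _) (hF.norm.intervalIntegrable _ _)
    · linarith [neg_abs_le y]
    · linarith
    · linarith [le_abs_self y]
  refine h1.trans ((fzF_half X (T + |y|) hX (by linarith) (by linarith)).trans ?_)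
  have hl : 0 ≤ Real.log T := Real.log_nonneg (by linarith)
  have h2 : T + |y| ≤ T * (1 + |y|) := by nlinarith
  have h3 : 1 + Real.log (T + |y|) ≤ (1 + Real.log T) * (1 + |y|) := by
    have : Real.log (T + |y|) ≤ Real.log T + |y| := by
      refine (Real.log_le_log (by linarith) h2).trans ?_
      rw [Real.log_mul (by linarith) (by linarith)]
      have := Real.log_le_sub_one_of_pos (x := 1 + |y|) (by linarith)
      linarith
    nlinarith
  have h4 : 0 ≤ 1 + Real.log (T + |y|) := by
    have := Real.log_nonneg (x := T + |y|) (by linarith)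
    linarith
  calc 155 * (T + |y|) * (1 + Real.log (T + |y|))^2 ≤ 155 * (T * (1 + |y|)) * ((1 + Real.log T) * (1 + |y|))^2 := by
        gcongr
    _ = _ := by ring

/-- The constant in the convexity estimate. -/
noncomputable def fzK : ℝ := 1240 * Real.exp 1 * Real.exp (9/4)

lemma fzK_pos : 0 < fzK := by unfold fzK; positivity

lemma fz_conv (X : ℕ) (T : ℝ) (hX : 1 ≤ X) (hXT : (X:ℝ) ≤ T) (hT : 2 ≤ T) (σ : ℝ) (hσ : 1/2 ≤ σ) (hσ2 : σ ≤ 2) :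
    ∫ t in (-T)..T, ‖fzF X (σ + t * I)‖ ≤ fzK * T * (1 + Real.log T)^2 * (X:ℝ) ^ (-((σ - 1/2) / (2 - 1/2))) := by
  have hX0 : (0:ℝ) < X := by exact_mod_cast hX
  have hl : 0 ≤ Real.log T := Real.log_nonneg (by linarith)
  have hle : -T ≤ T := by linarith
  set φ : ℝ → ℂ := fun t => (starRingEnd ℂ) (fzF X (σ + t * I)) / ‖fzF X (σ + t * I)‖ with hφ
  have hFc := fzF_line_cont X σ (by linarith)
  have hφm : Measurable φ := by
    refine Measurable.div ?_ ?_
    · exact (Complex.continuous_conj.comp hFc).measurable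
    · exact (Complex.continuous_ofReal.comp hFc.norm).measurable
  have hφ1 : ∀ t, ‖φ t‖ ≤ 1 := by
    intro t
    simp only [hφ, norm_div, RCLike.norm_conj, Complex.norm_real, norm_norm]
    exact div_self_le_one _
  set Ψ : ℂ → ℂ := fun z => ∫ t in (-T)..T, fzF X (z + t * I) * φ t with hΨ
  set Φ : ℂ → ℂ := fun z => Complex.exp ((z - σ)^2) * Ψ z with hΦ
  have hΨb : ∀ z : ℂ, 1/2 ≤ z.re → ‖Ψ z‖ ≤ ∫ t in (-T)..T, ‖fzF X (z.re + (z.im + t : ℝ) * I)‖ := by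
    intro z hz
    have hc : Continuous (fun t : ℝ => fzF X (z.re + (z.im + t : ℝ) * I)) :=
      (fzF_line_cont X z.re (by linarith)).comp (by fun_prop : Continuous fun t : ℝ => z.im + t)
    refine intervalIntegral.norm_integral_le_of_norm_le hle (ae_of_all _ fun t _ => ?_) (hc.norm.intervalIntegrable _ _)
    rw [norm_mul]
    refine (mul_le_of_le_one_right (norm_nonneg _) (hφ1 t)).trans (le_of_eq ?_)
    congr 2
    nth_rw 1 [← Complex.re_add_im z]
    push_cast; ring
  have hΦσ : Φ σ = ((∫ t in (-T)..T, ‖fzF X (σ + t * I)‖ : ℝ) : ℂ) := by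
    simp only [hΦ, hΨ, sub_self]
    rw [← intervalIntegral.integral_ofReal]
    simp only [ne_eq, OfNat.ofNat_ne_zero, not_false_eq_true, zero_pow, Complex.exp_zero, one_mul]
    refine intervalIntegral.integral_congr fun t _ => ?_
    simp only [hφ]
    by_cases h0 : fzF X (σ + t * I) = 0
    · simp [h0]
    · have : ((‖fzF X (σ + t * I)‖ : ℝ) : ℂ) ≠ 0 := by simpa using h0
      rw [mul_div_assoc', Complex.mul_conj, Complex.normSq_eq_norm_sq]
      push_cast
      field_simp
  have hdiff : ∀ z : ℂ, 0 < z.re → DifferentiableAt ℂ Φ z := by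
    intro z hz
    have h1 := fz_param_diff (fzF X) (fzF_diff X) φ hφm hφ1 (-T) T z hz
    have h2 : DifferentiableAt ℂ (fun z : ℂ => Complex.exp ((z - σ)^2)) z := by fun_prop
    exact h2.mul h1
  set A := fzK * T * (1 + Real.log T)^2 with hA
  have hA0 : 0 < A := by have := fzK_pos; positivity
  have key := Complex.HadamardThreeLines.norm_le_interp_of_mem_verticalClosedStrip' (f := Φ) (z := (σ : ℂ)) (a := A) (b := A / X) (l := 1/2) (u := 2)
    (by norm_num) (by simp only [Complex.HadamardThreeLines.verticalClosedStrip, mem_preimage, Complex.ofReal_re]; exact ⟨hσ, hσ2⟩) ?_ ?_ ?_ ?_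
  · rw [hΦσ, Complex.norm_real, Real.norm_eq_abs, Complex.ofReal_re] at key
    refine (le_abs_self _).trans (key.trans (le_of_eq ?_))
    rw [Real.div_rpow hA0.le hX0.le, ← mul_div_assoc, ← Real.rpow_add hA0, Real.rpow_neg hX0.le]
    simp [div_eq_mul_inv]
  · refine DifferentiableOn.diffContOnCl fun z hz => (hdiff z ?_).differentiableWithinAt
    have : z ∈ re ⁻¹' Icc (1/2) 2 := by
      refine closure_minimal (preimage_mono Ioo_subset_Icc_self) (isClosed_Icc.preimage Complex.continuous_re) hz
    linarith [this.1]
  · refine ⟨Real.exp (9/4) * (8 * Real.exp 1) * (2 * T * ((6 + 2 * T) * X + 1)), ?_⟩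
    rintro _ ⟨z, hz, rfl⟩
    have hz1 : 1/2 ≤ z.re := hz.1
    have hz2 : z.re ≤ 2 := hz.2
    have hy := abs_nonneg z.im
    simp only [Function.comp_apply, hΦ, norm_mul]
    have h1 := fz_exp_norm z σ hσ hσ2 hz1 hz2
    have h2 : ‖Ψ z‖ ≤ (2 * T * ((6 + 2 * T) * X + 1)) * (1 + |z.im|) := by
      refine (hΨb z hz1).trans ?_
      have hc : Continuous (fun t : ℝ => fzF X (z.re + (z.im + t : ℝ) * I)) :=
        (fzF_line_cont X z.re (by linarith)).comp (by fun_prop : Continuous fun t : ℝ => z.im + t)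
      calc _ ≤ ∫ t in (-T)..T, ((6 + 2 * T) * X + 1) * (1 + |z.im|) := by
            refine intervalIntegral.integral_mono_on hle (hc.norm.intervalIntegrable _ _) intervalIntegrable_const fun t ht => ?_
            refine (fzF_growth X _ (by simpa using hz1)).trans ?_
            have hn : ‖(z.re + (z.im + t : ℝ) * I : ℂ)‖ ≤ 2 + |z.im| + T := by
              refine (norm_add_le _ _).trans ?_
              rw [norm_mul, Complex.norm_I, mul_one, Complex.norm_real, Complex.norm_real, Real.norm_eq_abs, Real.norm_eq_abs]
              have a1 : |z.re| ≤ 2 := abs_le.2 ⟨by linarith, hz2⟩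
              have a2 : |t| ≤ T := abs_le.2 ht
              have a3 := abs_add_le z.im t
              linarith
            have hx1 : (1:ℝ) ≤ X := by exact_mod_cast hX
            have : (2 + 2 * ‖(z.re + (z.im + t : ℝ) * I : ℂ)‖) * X ≤ ((6 + 2 * T) * (1 + |z.im|)) * X := by
              gcongr
              nlinarith
            nlinarith
        _ = _ := by
            rw [intervalIntegral.integral_const, smul_eq_mul]; ring
    have h3 := fz_exp_cube z.im
    have h4 : (1 + |z.im|) ≤ (1 + |z.im|)^3 := by
      refine le_self_pow₀ (by linarith) (by norm_num)
    have hK : 0 ≤ 2 * T * ((6 + 2 * T) * X + 1) := by positivity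
    calc _ ≤ (Real.exp (9/4) * Real.exp (-z.im^2)) * ((2 * T * ((6 + 2 * T) * X + 1)) * (1 + |z.im|)^3) := by
          refine mul_le_mul h1 (h2.trans (by gcongr)) (norm_nonneg _) (by positivity)
      _ = Real.exp (9/4) * ((1 + |z.im|)^3 * Real.exp (-z.im^2)) * (2 * T * ((6 + 2 * T) * X + 1)) := by ring
      _ ≤ _ := by gcongr
  · intro z hz
    have hz : z.re = 1/2 := hz
    have hy := abs_nonneg z.im
    simp only [hΦ, norm_mul]
    have h1 := fz_exp_norm z σ hσ hσ2 (by linarith) (by linarith)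
    have h2 := hΨb z (by linarith)
    rw [hz] at h2
    have h5 := fz_left_edge X T hX hXT hT z.im
    push_cast at h2 h5
    have h3 := fz_exp_cube z.im
    calc _ ≤ (Real.exp (9/4) * Real.exp (-z.im^2)) * (155 * T * (1 + Real.log T)^2 * (1 + |z.im|)^3) := by
          refine mul_le_mul h1 (h2.trans h5) (norm_nonneg _) (by positivity)
      _ = Real.exp (9/4) * (155 * T * (1 + Real.log T)^2) * ((1 + |z.im|)^3 * Real.exp (-z.im^2)) := by ring
      _ ≤ Real.exp (9/4) * (155 * T * (1 + Real.log T)^2) * (8 * Real.exp 1) := by gcongr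
      _ = A := by rw [hA, fzK]; ring
  · intro z hz
    have hz : z.re = 2 := hz
    simp only [hΦ, norm_mul]
    have h1 := fz_exp_norm z σ hσ hσ2 (by linarith) (by linarith)
    have h2 := hΨb z (by linarith)
    have hc : Continuous (fun t : ℝ => fzF X (z.re + (z.im + t : ℝ) * I)) :=
      (fzF_line_cont X z.re (by linarith)).comp (by fun_prop : Continuous fun t : ℝ => z.im + t)
    have h5 : ∫ t in (-T)..T, ‖fzF X (z.re + (z.im + t : ℝ) * I)‖ ≤ ∫ t in (-T)..T, 2 / (X:ℝ) := by
      refine intervalIntegral.integral_mono_on hle (hc.norm.intervalIntegrable _ _) intervalIntegrable_const fun t ht => ?_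
      refine (fzF_le X _ (by simp [hz]) ?_).trans (fz_two X hX _ (by simp [hz]))
      intro h; have := congrArg Complex.re h; simp [hz] at this
    rw [intervalIntegral.integral_const, smul_eq_mul] at h5
    have h6 : Real.exp (-z.im^2) ≤ 1 := Real.exp_le_one_iff.2 (by nlinarith [sq_nonneg z.im])
    have h7 : (1:ℝ) ≤ Real.exp 1 := Real.one_le_exp (by norm_num)
    have h8 : (1:ℝ) ≤ (1 + Real.log T)^2 := by nlinarith
    calc _ ≤ (Real.exp (9/4) * 1) * ((T - -T) * (2 / X)) := by
          refine mul_le_mul (h1.trans (by gcongr)) (h2.trans h5) (norm_nonneg _) (by positivity)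
      _ = (4 * 1 * Real.exp (9/4)) * T * 1 / X := by ring
      _ ≤ A / X := by
          rw [hA, fzK]
          gcongr
          · norm_num

lemma fz_jensen_lb (f : ℂ → ℂ) (c : ℂ) (R r : ℝ) (hr : 0 < r) (hrR : r < R)
    (h₁f : AnalyticOnNhd ℂ f (Metric.closedBall c R)) (h₂f : f c ≠ 0)
    (Z : Finset ℂ) (hZ : ∀ u ∈ Z, ‖c - u‖ ≤ r) :
    ∑ u ∈ Z, (analyticOrderNatAt f u : ℝ) * Real.log (R / r) ≤
      Real.circleAverage (fun z => Real.log ‖f z‖) c R - Real.log ‖f c‖ := by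
  have hR : 0 < R := hr.trans hrR
  have habs : |R| = R := abs_of_pos hR
  have h₁f' : AnalyticOnNhd ℂ f (Metric.closedBall c |R|) := by rwa [habs]
  have J := h₁f'.circleAverage_log_norm hR.ne' h₂f
  rw [habs] at J
  set D := MeromorphicOn.divisor f (Metric.closedBall c R) with hD
  have hDnn : ∀ u, (0:ℝ) ≤ (D u : ℝ) := fun u => by exact_mod_cast MeromorphicOn.AnalyticOnNhd.divisor_nonneg h₁f u
  have hfin : (Function.support fun u => (D u : ℝ) * Real.log (R * ‖c - u‖⁻¹)).Finite := by
    refine (D.finiteSupport (isCompact_closedBall c R)).subset fun u hu => ?_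
    simp only [Function.mem_support] at hu ⊢
    intro h; apply hu; simp [h]
  have hterm : ∀ u, 0 ≤ (D u : ℝ) * Real.log (R * ‖c - u‖⁻¹) := by
    intro u
    by_cases hu : u ∈ Metric.closedBall c R
    · refine mul_nonneg (hDnn u) ?_
      rcases eq_or_ne u c with rfl | hne
      · simp
      · have h0 : 0 < ‖c - u‖ := norm_pos_iff.2 (sub_ne_zero.2 hne.symm)
        refine Real.log_nonneg ?_
        rw [← div_eq_mul_inv, one_le_div h0]
        rw [Metric.mem_closedBall, dist_comm, dist_eq_norm] at hu
        exact hu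
    · have : D u = 0 := Function.locallyFinsuppWithin.apply_eq_zero_of_notMem D hu
      simp [this]
  have hcp : c ∈ Metric.closedBall c R := Metric.mem_closedBall_self hR.le
  have hc0 : analyticOrderAt f c = 0 := (h₁f c hcp).analyticOrderAt_eq_zero.2 h₂f
  have hval : ∀ u ∈ Metric.closedBall c R, (D u : ℝ) = analyticOrderNatAt f u := by
    intro u hu
    have h1 : analyticOrderAt f u ≠ ⊤ :=
      h₁f.analyticOrderAt_ne_top_of_isPreconnected (convex_closedBall c R).isPreconnected hcp hu (by rw [hc0]; simp)
    rw [hD, MeromorphicOn.AnalyticOnNhd.divisor_apply h₁f hu]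
    have h2 : analyticOrderAt f u = (analyticOrderNatAt f u : ℕ∞) := (Nat.cast_analyticOrderNatAt h1).symm
    rw [h2]
    simp
  have hle : ∀ u ∈ Z, (analyticOrderNatAt f u : ℝ) * Real.log (R / r) ≤ (D u : ℝ) * Real.log (R * ‖c - u‖⁻¹) := by
    intro u hu
    have hu' := hZ u hu
    have hub : u ∈ Metric.closedBall c R := by
      rw [Metric.mem_closedBall, dist_comm, dist_eq_norm]; linarith
    rw [hval u hub]
    rcases eq_or_ne u c with rfl | hne
    · simp [analyticOrderNatAt, hc0]
    · have h0 : 0 < ‖c - u‖ := norm_pos_iff.2 (sub_ne_zero.2 hne.symm)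
      rw [← div_eq_mul_inv]
      gcongr
  have hsum : ∑ u ∈ Z, (D u : ℝ) * Real.log (R * ‖c - u‖⁻¹) ≤ ∑ᶠ u, (D u : ℝ) * Real.log (R * ‖c - u‖⁻¹) := by
    rw [finsum_eq_sum_of_support_subset (s := hfin.toFinset ∪ Z) _ (by simp)]
    exact Finset.sum_le_sum_of_subset_of_nonneg Finset.subset_union_right fun u _ _ => hterm u
  have := (Finset.sum_le_sum hle).trans hsum
  linarith

lemma fz_log_lb (G : ℂ) (e : ℝ) (he : e ≤ 1/2) (h : ‖G - 1‖ ≤ e) : G ≠ 0 ∧ -(2 * e) ≤ Real.log ‖G‖ := by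
  have h1 : 1 - e ≤ ‖G‖ := by
    have := norm_sub_norm_le (1:ℂ) G
    rw [norm_one, norm_sub_rev] at this; linarith
  have h0 : 0 < ‖G‖ := by linarith
  refine ⟨norm_pos_iff.1 h0, ?_⟩
  have h2 := Real.one_sub_inv_le_log_of_pos h0
  have h3 : ‖G‖⁻¹ ≤ 1 + 2 * e := by
    rw [inv_le_iff_one_le_mul₀ h0]
    have he0 : 0 ≤ e := (norm_nonneg _).trans h
    nlinarith
  linarith

lemma fz_log_ub (G : ℂ) : Real.log ‖G‖ ≤ ‖G - 1‖ := by
  rcases eq_or_ne G 0 with rfl | h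
  · simp
  · have h0 : 0 < ‖G‖ := norm_pos_iff.2 h
    have := Real.log_le_sub_one_of_pos h0
    have h2 := norm_sub_norm_le G 1
    rw [norm_one] at h2; linarith

lemma fz_circle_pt (β₀ ε t : ℝ) (z : ℂ) (hz : z ∈ Metric.closedBall (2 + t * I : ℂ) (2 - β₀ + ε)) :
    β₀ - ε ≤ z.re ∧ |z.im - t| ≤ 2 - β₀ + ε := by
  rw [Metric.mem_closedBall, dist_eq_norm] at hz
  have h1 := Complex.abs_re_le_norm (z - (2 + t * I : ℂ))
  have h2 := Complex.abs_im_le_norm (z - (2 + t * I : ℂ))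
  have h3 := (abs_le.1 (h1.trans hz)).1
  have h4 := h2.trans hz
  simp at h3 h4
  exact ⟨by linarith, h4⟩

lemma fz_local (X : ℕ) (hX : 4 ≤ X) (β₀ ε t : ℝ) (hε : 0 < ε) (hβ : 1/2 + ε ≤ β₀) (hβ1 : β₀ ≤ 1)
    (ht : 3 ≤ |t|) (Z : Finset ℂ) (hZ : ∀ ρ ∈ Z, riemannZeta ρ = 0 ∧ β₀ ≤ ρ.re ∧ ρ.re < 1 ∧ |ρ.im - t| ≤ ε / 2) :
    (ε / 3) * ∑ ρ ∈ Z, (analyticOrderNatAt riemannZeta ρ : ℝ) ≤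
      3 * Real.circleAverage (fun z => ‖fzF X z‖) (2 + t * I) (2 - β₀ + ε) + 4 / X := by
  set R := 2 - β₀ + ε with hR
  set c : ℂ := 2 + t * I with hc
  have hR0 : 0 < R := by linarith
  have hR32 : R ≤ 3/2 := by linarith
  have hX0 : (0:ℝ) < X := by exact_mod_cast (by omega : 0 < X)
  have him : ∀ z ∈ Metric.closedBall c R, 3/2 ≤ |z.im| := by
    intro z hz
    have := (fz_circle_pt β₀ ε t z hz).2
    have h3 := abs_sub_abs_le_abs_sub t z.im
    rw [abs_sub_comm] at h3
    linarith
  have hre : ∀ z ∈ Metric.closedBall c R, 1/2 ≤ z.re := by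
    intro z hz
    have := (fz_circle_pt β₀ ε t z hz).1
    linarith
  have hne1 : ∀ z ∈ Metric.closedBall c R, z ≠ 1 := by
    rintro z hz rfl
    have := him 1 hz
    norm_num at this
  have hζ : ∀ z : ℂ, z ≠ 1 → AnalyticAt ℂ riemannZeta z := by
    intro z hz
    refine DifferentiableOn.analyticAt (s := {1}ᶜ) (fun w hw => ?_) (isOpen_compl_singleton.mem_nhds hz)
    exact (differentiableAt_riemannZeta hw).differentiableWithinAt
  have hM : ∀ z : ℂ, AnalyticAt ℂ (fzM X) z := fun z =>
    Differentiable.analyticAt (fun w => fzM_diff X w) z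
  have hG : AnalyticOnNhd ℂ (riemannZeta * fzM X) (Metric.closedBall c R) := fun z hz =>
    (hζ z (hne1 z hz)).mul (hM z)
  have hce : ‖(riemannZeta * fzM X) c - 1‖ ≤ 2 / X := fz_two X (by omega) c (by simp [hc])
  have h2X : (2:ℝ) / X ≤ 1/2 := by
    rw [div_le_iff₀ hX0]
    have : (4:ℝ) ≤ X := by exact_mod_cast hX
    linarith
  obtain ⟨hGc, hGl⟩ := fz_log_lb _ _ h2X hce
  have hdist : ∀ u ∈ Z, ‖c - u‖ ≤ R - ε / 2 := by
    intro u hu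
    obtain ⟨_, h1, h2, h3⟩ := hZ u hu
    refine (Complex.norm_le_abs_re_add_abs_im _).trans ?_
    have e1 : (c - u).re = 2 - u.re := by simp [hc]
    have e2 : (c - u).im = t - u.im := by simp [hc]
    rw [e1, e2, abs_of_pos (by linarith), abs_sub_comm]
    linarith
  have J := fz_jensen_lb _ c R (R - ε/2) (by linarith) (by linarith) hG hGc Z hdist
  have hcmp : Real.circleAverage (fun z => Real.log ‖(riemannZeta * fzM X) z‖) c R ≤
      Real.circleAverage (fun z => 3 * ‖fzF X z‖) c R := by
    have habs : |R| = R := abs_of_pos hR0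
    apply Real.circleAverage_mono
    · exact ((hG.mono Metric.sphere_subset_closedBall).meromorphicOn).circleIntegrable_log_norm_of_nonneg hR0.le
    · refine ContinuousOn.circleIntegrable hR0.le ?_
      refine continuousOn_const.mul (ContinuousOn.norm fun z hz => ?_)
      exact (fzF_diff X z (by linarith [hre z (Metric.sphere_subset_closedBall hz)])).continuousAt.continuousWithinAt
    · intro z hz
      rw [habs] at hz
      exact (fz_log_ub _).trans (fzF_ge X z (him z (Metric.sphere_subset_closedBall hz)))
  have hmul : Real.circleAverage (fun z => 3 * ‖fzF X z‖) c R = 3 * Real.circleAverage (fun z => ‖fzF X z‖) c R := by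
    have := Real.circleAverage_fun_smul (a := (3:ℝ)) (f := fun z => ‖fzF X z‖) (c := c) (R := R)
    simpa using this
  have hlog : ε / 3 ≤ Real.log (R / (R - ε / 2)) := by
    have h := Real.one_sub_inv_le_log_of_pos (x := R / (R - ε/2)) (div_pos hR0 (by linarith))
    refine le_trans ?_ h
    rw [inv_div, le_sub_iff_add_le, ← le_sub_iff_add_le', div_le_iff₀ hR0]
    nlinarith
  have hord : ∀ u ∈ Z, (ε/3) * (analyticOrderNatAt riemannZeta u : ℝ) ≤ (analyticOrderNatAt (riemannZeta * fzM X) u : ℝ) * Real.log (R / (R - ε/2)) := by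
    intro u hu
    have hub : u ∈ Metric.closedBall c R := by
      rw [Metric.mem_closedBall, dist_comm, dist_eq_norm]; linarith [hdist u hu]
    have hcp : c ∈ Metric.closedBall c R := Metric.mem_closedBall_self hR0.le
    have h1 : analyticOrderAt (riemannZeta * fzM X) u ≠ ⊤ :=
      hG.analyticOrderAt_ne_top_of_isPreconnected (convex_closedBall c R).isPreconnected hcp hub
        (by rw [(hG c hcp).analyticOrderAt_eq_zero.2 hGc]; simp)
    have h2 := analyticOrderAt_mul (hζ u (hne1 u hub)) (hM u)
    rw [h2] at h1
    have h3 : analyticOrderNatAt riemannZeta u ≤ analyticOrderNatAt (riemannZeta * fzM X) u := by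
      unfold analyticOrderNatAt
      rw [h2]
      exact ENat.toNat_le_toNat le_self_add h1
    have h3' : (analyticOrderNatAt riemannZeta u : ℝ) ≤ analyticOrderNatAt (riemannZeta * fzM X) u := by exact_mod_cast h3
    rw [mul_comm]
    exact mul_le_mul h3' hlog (by positivity) (by positivity)
  have hS := Finset.sum_le_sum hord
  rw [← Finset.mul_sum] at hS
  have : 2 * (2 / (X:ℝ)) = 4 / X := by ring
  linarith

lemma fz_conv2 (X : ℕ) (T : ℝ) (hX : 1 ≤ X) (hXT : (X:ℝ) ≤ T) (hT : 2 ≤ T) (σ₀ σ : ℝ) (h0 : 1/2 ≤ σ₀)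
    (h02 : σ₀ ≤ 2) (hσ : σ₀ ≤ σ) :
    ∫ t in (-T)..T, ‖fzF X (σ + t * I)‖ ≤
      fzK * T * (1 + Real.log T)^2 * (X:ℝ) ^ (-((σ₀ - 1/2) / (2 - 1/2))) := by
  have hX1 : (1:ℝ) ≤ X := by exact_mod_cast hX
  have hK := fzK_pos
  have hl : 0 ≤ Real.log T := Real.log_nonneg (by linarith)
  rcases le_or_gt σ 2 with h2 | h2
  · refine (fz_conv X T hX hXT hT σ (by linarith) h2).trans ?_
    gcongr
  · have hb : ∀ t ∈ Set.uIoc (-T) T, ‖‖fzF X (σ + t * I)‖‖ ≤ 2 / X := by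
      intro t _
      rw [norm_norm]
      refine (fzF_le X _ (by simp; linarith) ?_).trans (fz_two X hX _ (by simp; linarith))
      intro h
      have := congrArg Complex.re h
      simp at this
      linarith
    have := intervalIntegral.norm_integral_le_of_norm_le_const hb
    refine (le_trans (le_abs_self _) this).trans ?_
    have e : |T - -T| = 2 * T := by rw [abs_of_pos (by linarith)]; ring
    rw [e]
    have hX' : (X:ℝ)⁻¹ ≤ (X:ℝ) ^ (-((σ₀ - 1/2) / (2 - 1/2))) := by
      rw [← Real.rpow_neg_one]
      apply Real.rpow_le_rpow_of_exponent_le hX1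
      rw [neg_le_neg_iff, div_le_one (by norm_num)]
      linarith
    have hK4 : 4 ≤ fzK := by
      unfold fzK
      have h1 : 1 ≤ Real.exp 1 := Real.one_le_exp (by norm_num)
      have h2 : 1 ≤ Real.exp (9/4) := Real.one_le_exp (by norm_num)
      nlinarith
    calc 2 / (X:ℝ) * (2 * T) = 4 * T * 1 * (X:ℝ)⁻¹ := by ring
      _ ≤ _ := by
        gcongr
        nlinarith

lemma fz_int_ind (a b u v c : ℝ) (hu : a < u) (hv : v ≤ b) (huv : u ≤ v) :
    ∫ t in a..b, (Set.Icc u v).indicator (fun _ => c) t = (v - u) * c := by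
  rw [intervalIntegral.integral_of_le (by linarith), setIntegral_indicator measurableSet_Icc,
    Set.inter_eq_right.2 (show Set.Icc u v ⊆ Set.Ioc a b from fun x hx => ⟨by linarith [hx.1], by linarith [hx.2]⟩)]
  rw [setIntegral_const]
  simp [huv]

lemma fz_swap (G : ℝ → ℝ → ℝ) (hGc : Continuous (Function.uncurry G)) (a b B : ℝ)
    (hinner : ∀ θ, ∫ t in a..b, G t θ ≤ B) :
    ∫ t in a..b, (2 * π)⁻¹ * ∫ θ in (0:ℝ)..(2 * π), G t θ ≤ B := by
  have hpi : 0 < 2 * π := by positivity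
  have hG2 : Continuous (Function.uncurry fun θ t => G t θ) := hGc.comp continuous_swap
  rw [intervalIntegral.integral_const_mul]
  have hsw : ∫ t in a..b, ∫ θ in (0:ℝ)..(2 * π), G t θ = ∫ θ in (0:ℝ)..(2 * π), ∫ t in a..b, G t θ := by
    apply intervalIntegral_intervalIntegral_swap
    have hK : IsCompact (Set.uIcc a b ×ˢ Set.uIcc 0 (2 * π)) := isCompact_uIcc.prod isCompact_uIcc
    exact (hGc.continuousOn.integrableOn_compact hK).mono_set
      (Set.prod_mono uIoc_subset_uIcc uIoc_subset_uIcc)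
  rw [hsw]
  have hc2 : Continuous fun θ => ∫ t in a..b, G t θ :=
    intervalIntegral.continuous_parametric_intervalIntegral_of_continuous' hG2 _ _
  have h1 : ∫ θ in (0:ℝ)..(2 * π), (∫ t in a..b, G t θ) ≤ ∫ θ in (0:ℝ)..(2 * π), B := by
    refine intervalIntegral.integral_mono_on hpi.le (hc2.intervalIntegrable _ _) (by simp) fun θ _ => hinner θ
  rw [intervalIntegral.integral_const, sub_zero, smul_eq_mul] at h1
  calc _ ≤ (2 * π)⁻¹ * (2 * π * B) := by gcongr
    _ = B := by field_simp

lemma fz_density (X : ℕ) (T : ℝ) (hX : 4 ≤ X) (hXT : (X:ℝ) ≤ T) (ε β₀ : ℝ) (hε : 0 < ε)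
    (hε1 : ε ≤ 1/4) (hβ : 1/2 + ε ≤ β₀) (hβ1 : β₀ ≤ 1) (Z : Finset ℂ)
    (hZ : ∀ ρ ∈ Z, riemannZeta ρ = 0 ∧ β₀ ≤ ρ.re ∧ ρ.re < 1 ∧ 4 ≤ |ρ.im| ∧ |ρ.im| ≤ T) :
    (ε^2/3) * ∑ ρ ∈ Z, (analyticOrderNatAt riemannZeta ρ : ℝ) ≤
      3 * (fzK * (T+3) * (1 + Real.log (T+3))^2 * (X:ℝ) ^ (-((β₀ - ε - 1/2) / (2 - 1/2))))
        + (4 / X) * (2 * T + 2) := by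
  have hX4 : (4:ℝ) ≤ X := by exact_mod_cast hX
  have hT : 4 ≤ T := hX4.trans hXT
  set R := 2 - β₀ + ε with hR
  have hR0 : 0 < R := by linarith
  set B := fzK * (T+3) * (1 + Real.log (T+3))^2 * (X:ℝ) ^ (-((β₀ - ε - 1/2) / (2 - 1/2))) with hB
  set G : ℝ → ℝ → ℝ := fun t θ => ‖fzF X (circleMap (2 + t * I) R θ)‖ with hG
  have hre : ∀ t θ : ℝ, circleMap (2 + t * I) R θ = ((2 + R * Real.cos θ : ℝ) : ℂ) + ((t + R * Real.sin θ : ℝ) : ℂ) * I := by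
    intro t θ
    rw [circleMap, Complex.exp_mul_I]
    push_cast
    ring
  have hcos : ∀ θ : ℝ, β₀ - ε ≤ 2 + R * Real.cos θ := by
    intro θ
    nlinarith [Real.neg_one_le_cos θ]
  have hGc : Continuous (Function.uncurry G) := by
    rw [continuous_iff_continuousAt]
    rintro ⟨t, θ⟩
    have h1 : ContinuousAt (fun p : ℝ × ℝ => circleMap (2 + p.1 * I) R p.2) (t, θ) := by
      unfold circleMap
      fun_prop
    have h2 : ContinuousAt (fzF X) (circleMap (2 + t * I) R θ) := by
      refine (fzF_diff X _ ?_).continuousAt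
      rw [hre]
      have := hcos θ
      simp only [Complex.add_re, Complex.ofReal_re, Complex.mul_re, Complex.I_re, Complex.I_im, Complex.ofReal_im]
      linarith
    have h3 : ContinuousAt (fun p : ℝ × ℝ => fzF X (circleMap (2 + p.1 * I) R p.2)) (t, θ) :=
      ContinuousAt.comp (g := fzF X) (f := fun p : ℝ × ℝ => circleMap (2 + p.1 * I) R p.2) h2 h1
    exact h3.norm
  have hinner : ∀ θ : ℝ, ∫ t in (-(T+1))..(T+1), G t θ ≤ B := by
    intro θ
    have hs1 := Real.sin_le_one θ
    have hs2 := Real.neg_one_le_sin θ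
    have e : ∀ t : ℝ, G t θ = (fun t : ℝ => ‖fzF X (((2 + R * Real.cos θ : ℝ) : ℂ) + t * I)‖) (t + R * Real.sin θ) := by
      intro t
      simp only [hG, hre]
    simp_rw [e]
    rw [intervalIntegral.integral_comp_add_right (fun t : ℝ => ‖fzF X (((2 + R * Real.cos θ : ℝ) : ℂ) + t * I)‖)]
    have hcont := (fzF_line_cont X (2 + R * Real.cos θ) (by linarith [hcos θ])).norm
    refine le_trans ?_ (fz_conv2 X (T+3) (by omega) (by linarith) (by linarith) (β₀ - ε) (2 + R * Real.cos θ) (by linarith) (by linarith) (hcos θ))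
    refine intervalIntegral.integral_mono_interval (by nlinarith) (by nlinarith) (by nlinarith) ?_ (hcont.intervalIntegrable _ _)
    exact Eventually.of_forall fun t => norm_nonneg _
  set CA : ℝ → ℝ := fun t => Real.circleAverage (fun z => ‖fzF X z‖) (2 + t * I) R with hCA
  have hCA' : ∀ t, CA t = (2 * π)⁻¹ * ∫ θ in (0:ℝ)..(2 * π), G t θ := by
    intro t
    simp only [hCA, Real.circleAverage_def, smul_eq_mul, hG]
  have hCAc : Continuous CA := by
    have : CA = fun t => (2 * π)⁻¹ * ∫ θ in (0:ℝ)..(2 * π), G t θ := funext hCA'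
    rw [this]
    exact continuous_const.mul (intervalIntegral.continuous_parametric_intervalIntegral_of_continuous' hGc _ _)
  have hCAint : ∫ t in (-(T+1))..(T+1), CA t ≤ B := by
    simp_rw [hCA']
    exact fz_swap G hGc _ _ B hinner
  have hpt : ∀ t : ℝ, ∑ ρ ∈ Z, (Set.Icc (ρ.im - ε/2) (ρ.im + ε/2)).indicator
      (fun _ => ε/3 * (analyticOrderNatAt riemannZeta ρ : ℝ)) t ≤ 3 * CA t + 4 / X := by
    intro t
    have hCAnn : 0 ≤ CA t := by
      rw [hCA']
      refine mul_nonneg (by positivity) ?_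
      exact intervalIntegral.integral_nonneg (by positivity) fun θ _ => norm_nonneg _
    have e : ∑ ρ ∈ Z, (Set.Icc (ρ.im - ε/2) (ρ.im + ε/2)).indicator
      (fun _ => ε/3 * (analyticOrderNatAt riemannZeta ρ : ℝ)) t =
      (ε/3) * ∑ ρ ∈ Z.filter (fun ρ => |ρ.im - t| ≤ ε/2), (analyticOrderNatAt riemannZeta ρ : ℝ) := by
      rw [Finset.mul_sum, Finset.sum_filter]
      refine Finset.sum_congr rfl fun ρ _ => ?_
      rw [Set.indicator_apply]
      refine if_congr ?_ rfl rfl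
      rw [Set.mem_Icc, abs_le]
      constructor <;> rintro ⟨h1, h2⟩ <;> constructor <;> linarith
    rw [e]
    by_cases ht : 3 ≤ |t|
    · exact fz_local X hX β₀ ε t hε hβ hβ1 ht _ (fun ρ hρ => by
        rw [Finset.mem_filter] at hρ
        obtain ⟨h1, h2, h3, _⟩ := hZ ρ hρ.1
        exact ⟨h1, h2, h3, hρ.2⟩)
    · have : Z.filter (fun ρ => |ρ.im - t| ≤ ε/2) = ∅ := by
        rw [Finset.filter_eq_empty_iff]
        intro ρ hρ h
        obtain ⟨_, _, _, h4, _⟩ := hZ ρ hρ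
        have := abs_sub_abs_le_abs_sub ρ.im t
        linarith
      rw [this]
      simp only [Finset.sum_empty, mul_zero]
      positivity
  have hii : ∀ ρ ∈ Z, IntervalIntegrable ((Set.Icc (ρ.im - ε/2) (ρ.im + ε/2)).indicator
      (fun _ => ε/3 * (analyticOrderNatAt riemannZeta ρ : ℝ))) volume (-(T+1)) (T+1) := by
    intro ρ _
    have : Integrable ((Set.Icc (ρ.im - ε/2) (ρ.im + ε/2)).indicator
      (fun _ => ε/3 * (analyticOrderNatAt riemannZeta ρ : ℝ))) :=
      (integrable_indicator_iff measurableSet_Icc).2 (continuous_const.integrableOn_Icc)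
    exact this.intervalIntegrable
  have hI : ∫ t in (-(T+1))..(T+1), (∑ ρ ∈ Z, (Set.Icc (ρ.im - ε/2) (ρ.im + ε/2)).indicator
      (fun _ => ε/3 * (analyticOrderNatAt riemannZeta ρ : ℝ)) t) ≤ ∫ t in (-(T+1))..(T+1), (3 * CA t + 4 / X) := by
    refine intervalIntegral.integral_mono_on (by linarith) ?_ ?_ fun t _ => hpt t
    · have := IntervalIntegrable.sum Z hii
      have e : (fun t : ℝ => ∑ ρ ∈ Z, (Set.Icc (ρ.im - ε/2) (ρ.im + ε/2)).indicator
          (fun _ => ε/3 * (analyticOrderNatAt riemannZeta ρ : ℝ)) t) = ∑ ρ ∈ Z, (Set.Icc (ρ.im - ε/2) (ρ.im + ε/2)).indicator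
          (fun _ => ε/3 * (analyticOrderNatAt riemannZeta ρ : ℝ)) := by
        ext t
        rw [Finset.sum_apply]
      rw [e]
      exact this
    · exact ((continuous_const.mul hCAc).add continuous_const).intervalIntegrable _ _
  rw [intervalIntegral.integral_finsetSum hii] at hI
  have e1 : ∑ ρ ∈ Z, ∫ t in (-(T+1))..(T+1), (Set.Icc (ρ.im - ε/2) (ρ.im + ε/2)).indicator
      (fun _ => ε/3 * (analyticOrderNatAt riemannZeta ρ : ℝ)) t = (ε^2/3) * ∑ ρ ∈ Z, (analyticOrderNatAt riemannZeta ρ : ℝ) := by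
    rw [Finset.mul_sum]
    refine Finset.sum_congr rfl fun ρ hρ => ?_
    obtain ⟨_, _, _, h4, h5⟩ := hZ ρ hρ
    rw [abs_le] at h5
    rw [fz_int_ind _ _ _ _ _ (by linarith) (by linarith) (by linarith)]
    ring
  have e2 : ∫ t in (-(T+1))..(T+1), (3 * CA t + 4 / X) = 3 * (∫ t in (-(T+1))..(T+1), CA t) + (4 / X) * (2 * T + 2) := by
    have hA : IntervalIntegrable (fun t => 3 * CA t) volume (-(T+1)) (T+1) :=
      (continuous_const.mul hCAc).intervalIntegrable _ _
    have hC : IntervalIntegrable (fun _ : ℝ => 4 / (X:ℝ)) volume (-(T+1)) (T+1) :=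
      continuous_const.intervalIntegrable _ _
    rw [intervalIntegral.integral_add hA hC,
      intervalIntegral.integral_const_mul, intervalIntegral.integral_const, smul_eq_mul]
    ring
  rw [e1, e2] at hI
  linarith

lemma fz_Nk (T : ℝ) (hL : 4 ≤ Real.log T) (hT0 : 0 < T) (β₀ : ℝ) (hβ : 1/2 + 1 / Real.log T ≤ β₀) (hβ1 : β₀ ≤ 1)
    (Z : Finset ℂ)
    (hZ : ∀ ρ ∈ Z, riemannZeta ρ = 0 ∧ β₀ ≤ ρ.re ∧ ρ.re < 1 ∧ 4 ≤ |ρ.im| ∧ |ρ.im| ≤ T) :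
    ∑ ρ ∈ Z, (analyticOrderNatAt riemannZeta ρ : ℝ) ≤
      (3 * (144 * fzK + 32)) * T * Real.log T ^ 4 * Real.exp (-((2/3) * (β₀ - 1/2) * Real.log T)) := by
  set L := Real.log T with hLdef
  have hTL : T = Real.exp L := (Real.exp_log hT0).symm
  have hT5 : 5 ≤ T := by
    have := Real.add_one_le_exp L
    linarith
  have hK := fzK_pos
  set X := ⌊T⌋₊ with hX
  have hX4 : 4 ≤ X := Nat.le_floor (by push_cast; linarith)
  have hXT : (X:ℝ) ≤ T := Nat.floor_le hT0.le
  have hX2 : T / 2 ≤ X := by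
    have := Nat.lt_floor_add_one T
    rw [← hX] at this
    linarith
  have hL0 : 0 < L := by linarith
  have hε1 : 1 / L ≤ 1/4 := by
    rw [div_le_div_iff₀ hL0 (by norm_num)]; linarith
  have D := fz_density X T hX4 hXT (1/L) β₀ (by positivity) hε1 hβ hβ1 Z hZ
  set N := ∑ ρ ∈ Z, (analyticOrderNatAt riemannZeta ρ : ℝ) with hN
  set E := Real.exp (-((2/3) * (β₀ - 1/2) * L)) with hE
  have hE0 : 0 < E := Real.exp_pos _
  have hTE : 1 ≤ T * E := by
    rw [hTL, hE, ← Real.exp_add]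
    apply Real.one_le_exp
    nlinarith
  have hlog : 1 + Real.log (T + 3) ≤ 2 * L := by
    have h1 : Real.log (T+3) ≤ Real.log (2 * T) := Real.log_le_log (by linarith) (by linarith)
    rw [Real.log_mul (by norm_num) hT0.ne'] at h1
    have := Real.log_two_lt_d9
    linarith
  have hlog0 : 0 ≤ 1 + Real.log (T + 3) := by
    have := Real.log_nonneg (show 1 ≤ T + 3 by linarith)
    linarith
  have hpow : (X:ℝ) ^ (-((β₀ - 1/L - 1/2) / (2 - 1/2))) ≤ 6 * E := by
    set a := (β₀ - 1/L - 1/2) / (2 - 1/2) with ha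
    have ha0 : 0 ≤ a := div_nonneg (by linarith) (by norm_num)
    have ha1 : a ≤ 1 := by
      rw [ha, div_le_one (by norm_num)]
      have : 0 < 1 / L := by positivity
      linarith
    calc (X:ℝ) ^ (-a) ≤ (T/2) ^ (-a) := Real.rpow_le_rpow_of_nonpos (by linarith) hX2 (by linarith)
      _ = T ^ (-a) * 2 ^ a := by
        rw [Real.div_rpow hT0.le (by norm_num), Real.rpow_neg (x := 2) (by norm_num), div_inv_eq_mul]
      _ ≤ T ^ (-a) * 2 ^ (1:ℝ) := by gcongr; norm_num
      _ = E * Real.exp (2/3) * 2 := by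
        rw [Real.rpow_def_of_pos hT0, Real.rpow_one, hE, ← Real.exp_add, ← hLdef, ha]
        congr 2
        field_simp
        ring
      _ ≤ E * 3 * 2 := by
        have : Real.exp (2/3) ≤ Real.exp 1 := Real.exp_le_exp.2 (by norm_num)
        have := Real.exp_one_lt_d9
        gcongr
        linarith
      _ = 6 * E := by ring
  have h4X : 4 / (X:ℝ) * (2 * T + 2) ≤ 32 := by
    rw [div_mul_eq_mul_div, div_le_iff₀ (by linarith)]
    linarith
  have hmain : ((1/L)^2/3) * N ≤ (144 * fzK + 32) * T * L^2 * E := by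
    refine D.trans ?_
    calc _ ≤ 3 * (fzK * (2*T) * (2 * L)^2 * (6 * E)) + 32 := by
          gcongr
          linarith
      _ ≤ 3 * (fzK * (2*T) * (2 * L)^2 * (6 * E)) + 32 * (T * E) * L^2 := by
          have : 1 ≤ L^2 := by nlinarith
          nlinarith
      _ = _ := by ring
  have e : N = 3 * L^2 * (((1/L)^2/3) * N) := by field_simp
  rw [e]
  calc _ ≤ 3 * L^2 * ((144 * fzK + 32) * T * L^2 * E) := by gcongr
    _ = _ := by ring

lemma fz_zeta_an (z : ℂ) (hz : z ≠ 1) : AnalyticAt ℂ riemannZeta z := by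
  rw [Complex.analyticAt_iff_eventually_differentiableAt]
  filter_upwards [isOpen_ne.mem_nhds hz] with w hw
  exact differentiableAt_riemannZeta hw

lemma fz_ord_ne_top (z : ℂ) (hz : z ≠ 1) : analyticOrderAt riemannZeta z ≠ ⊤ := by
  have h1 : AnalyticOnNhd ℂ riemannZeta {(1:ℂ)}ᶜ := fun w hw => fz_zeta_an w hw
  have h2 : IsPreconnected ({(1:ℂ)}ᶜ : Set ℂ) :=
    (isConnected_compl_singleton_of_one_lt_rank (by simp) 1).isPreconnected
  refine h1.analyticOrderAt_ne_top_of_isPreconnected h2 (x := 2) (by simp) hz ?_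
  rw [(fz_zeta_an 2 (by norm_num)).analyticOrderAt_eq_zero.2 (riemannZeta_ne_zero_of_one_le_re (by norm_num))]
  simp

lemma fz_reflect (ρ : ℂ) (h0 : 0 < ρ.re) (h1 : ρ.re < 1) :
    analyticOrderNatAt riemannZeta ρ ≤ analyticOrderNatAt riemannZeta (1 - ρ) := by
  have hne : ρ ≠ 1 := by rintro rfl; simp at h1
  have hne' : 1 - ρ ≠ 1 := by
    intro h
    have : ρ = 0 := by linear_combination -h
    rw [this] at h0; simp at h0
  set h : ℂ → ℂ := fun s => 2 * (2 * π) ^ (-s) * Complex.Gamma s * Complex.cos (π * s / 2) with hh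
  have hopen : IsOpen {s : ℂ | 0 < s.re ∧ s.re < 1} :=
    (isOpen_lt continuous_const Complex.continuous_re).inter (isOpen_lt Complex.continuous_re continuous_const)
  have hev : ∀ᶠ s in nhds ρ, 0 < s.re ∧ s.re < 1 := hopen.mem_nhds ⟨h0, h1⟩
  have hnn : ∀ s : ℂ, 0 < s.re → ∀ n : ℕ, s ≠ -n := by
    intro s hs n e
    rw [e] at hs
    simp at hs
    linarith [Nat.cast_nonneg (α := ℝ) n]
  have hha : AnalyticAt ℂ h ρ := by
    rw [Complex.analyticAt_iff_eventually_differentiableAt]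
    filter_upwards [hev] with s hs
    have hΓ : DifferentiableAt ℂ Complex.Gamma s := Complex.differentiableAt_Gamma s (hnn s hs.1)
    have hp : DifferentiableAt ℂ (fun s : ℂ => (2 * π : ℂ) ^ (-s)) s := by
      refine DifferentiableAt.const_cpow (by fun_prop) (Or.inl ?_)
      simp [Real.pi_ne_zero]
    have hc : DifferentiableAt ℂ (fun s : ℂ => Complex.cos (π * s / 2)) s := by fun_prop
    exact ((hp.const_mul 2).mul hΓ).mul hc
  have heq : (riemannZeta ∘ fun s => 1 - s) =ᶠ[nhds ρ] h * riemannZeta := by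
    filter_upwards [hev] with s hs
    simp only [Function.comp, Pi.mul_apply, hh]
    exact riemannZeta_one_sub (hnn s hs.1) (by rintro rfl; simp at hs)
  have hcomp : analyticOrderAt (riemannZeta ∘ fun s => 1 - s) ρ = analyticOrderAt riemannZeta (1 - ρ) := by
    apply analyticOrderAt_comp_of_deriv_ne_zero (f := riemannZeta) (g := fun s : ℂ => 1 - s) (z₀ := ρ)
    · fun_prop
    · simp
  have hord := analyticOrderAt_congr heq
  rw [hcomp, analyticOrderAt_mul hha (fz_zeta_an ρ hne)] at hord
  unfold analyticOrderNatAt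
  refine ENat.toNat_le_toNat ?_ (fz_ord_ne_top _ hne')
  rw [hord]
  exact le_add_self

lemma fz_layer (T : ℝ) (hL : 2 ≤ Real.log (Real.log T)) (hL4 : 4 ≤ Real.log T) (hT0 : 0 < T) (δ : ℝ)
    (hδ : δ = 50 * Real.log (Real.log T) / Real.log T) (Z : Finset ℂ)
    (hZ : ∀ ρ ∈ Z, riemannZeta ρ = 0 ∧ 1/2 + δ ≤ ρ.re ∧ ρ.re < 1 ∧ 4 ≤ |ρ.im| ∧ |ρ.im| ≤ T) :
    ∑ ρ ∈ Z, (analyticOrderNatAt riemannZeta ρ : ℝ) * Real.exp ((ρ.re - 1/2) / δ) ≤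
      2 * (3 * (144 * fzK + 32)) * T / Real.log T ^ 10 := by
  have hK := fzK_pos
  set C := 3 * (144 * fzK + 32) with hC
  have hC0 : 0 < C := by positivity
  set L := Real.log T with hLdef
  set l := Real.log L with hl
  have hL0 : 0 < L := by linarith
  have hδ0 : 0 < δ := by rw [hδ]; positivity
  have hδL : δ * L = 50 * l := by rw [hδ]; field_simp
  set K := ⌊1 / (2 * δ)⌋₊ with hKd
  set κ : ℂ → ℕ := fun ρ => ⌊(ρ.re - 1/2) / δ⌋₊ with hκ
  set q := Real.exp (2 - (100/3) * l) with hq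
  have hmaps : ∀ ρ ∈ Z, κ ρ ∈ Finset.Icc 1 K := by
    intro ρ hρ
    obtain ⟨_, h2, h3, _⟩ := hZ ρ hρ
    rw [Finset.mem_Icc]
    constructor
    · apply Nat.le_floor
      rw [Nat.cast_one, one_le_div hδ0]
      linarith
    · apply Nat.floor_le_floor
      rw [div_le_div_iff₀ hδ0 (by positivity)]
      nlinarith
  rw [← Finset.sum_fiberwise_of_maps_to hmaps]
  have hk : ∀ k ∈ Finset.Icc 1 K, ∑ ρ ∈ Z with κ ρ = k, (analyticOrderNatAt riemannZeta ρ : ℝ) * Real.exp ((ρ.re - 1/2) / δ)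
      ≤ C * T * L^4 * q ^ k := by
    intro k hk
    rw [Finset.mem_Icc] at hk
    have hk1 : (1:ℝ) ≤ k := by exact_mod_cast hk.1
    have hkδ : k * δ ≤ 1/2 := by
      have h1 : (k:ℝ) ≤ 1 / (2 * δ) := (Nat.cast_le.2 hk.2).trans (Nat.floor_le (by positivity))
      rw [le_div_iff₀ (by positivity)] at h1
      linarith
    have hN := fz_Nk T hL4 hT0 (1/2 + k * δ) (by
        have : 1 / L ≤ δ := by rw [hδ]; gcongr; linarith
        nlinarith) (by linarith) (Z.filter fun ρ => κ ρ = k) (by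
        intro ρ hρ
        rw [Finset.mem_filter] at hρ
        obtain ⟨h1, h2, h3, h4⟩ := hZ ρ hρ.1
        refine ⟨h1, ?_, h3, h4⟩
        have h5 : (k:ℝ) ≤ (ρ.re - 1/2) / δ := by
          rw [← hρ.2]
          exact Nat.floor_le (div_nonneg (by linarith) hδ0.le)
        rw [le_div_iff₀ hδ0] at h5
        linarith)
    rw [← hC, ← hLdef] at hN
    calc _ ≤ ∑ ρ ∈ Z with κ ρ = k, (analyticOrderNatAt riemannZeta ρ : ℝ) * Real.exp (k + 1) := by
          refine Finset.sum_le_sum fun ρ hρ => ?_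
          rw [Finset.mem_filter] at hρ
          gcongr
          rw [← hρ.2]
          exact (Nat.lt_floor_add_one _).le
      _ = (∑ ρ ∈ Z with κ ρ = k, (analyticOrderNatAt riemannZeta ρ : ℝ)) * Real.exp (k + 1) := by
          rw [Finset.sum_mul]
      _ ≤ (C * T * L ^ 4 * Real.exp (-((2/3) * (1/2 + k * δ - 1/2) * L))) * Real.exp (k + 1) := by
          gcongr
      _ = C * T * L ^ 4 * Real.exp (k + 1 - (100/3) * k * l) := by
          rw [mul_assoc, ← Real.exp_add]
          congr 2
          linear_combination -(2/3) * k * hδL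
      _ ≤ C * T * L^4 * q ^ k := by
          rw [hq, ← Real.exp_nat_mul]
          gcongr
          nlinarith
  refine (Finset.sum_le_sum hk).trans ?_
  rw [← Finset.mul_sum]
  have hq0 : 0 < q := Real.exp_pos _
  have hq1 : q ≤ Real.exp (-(14 * l)) := Real.exp_le_exp.2 (by linarith)
  have hqh : q ≤ 1/2 := by
    have h1 : q ≤ Real.exp (-1) := Real.exp_le_exp.2 (by linarith)
    have h2 := Real.exp_neg_one_lt_half
    linarith
  have hgeo : ∀ K : ℕ, ∑ k ∈ Finset.Icc 1 K, q ^ k ≤ 2 * q - 2 * q ^ (K+1) := by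
    intro K
    induction K with
    | zero => simp
    | succ n ih =>
      rw [Finset.sum_Icc_succ_top (by omega)]
      have : q ^ (n + 1 + 1) = q ^ (n+1) * q := pow_succ _ _
      have h3 : 0 < q ^ (n+1) := by positivity
      nlinarith
  have hq14 : Real.exp (-(14 * l)) = (L^14)⁻¹ := by
    rw [Real.exp_neg, show (14 * l) = ((14:ℕ):ℝ) * l by norm_num, Real.exp_nat_mul, hl, Real.exp_log hL0]
  calc _ ≤ C * T * L^4 * (2 * (L^14)⁻¹) := by
        gcongr
        have := hgeo K
        have h3 : 0 < q ^ (K+1) := by positivity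
        linarith
    _ = _ := by field_simp

lemma fz_mult (ρ : ℂ) (h : ρ.re < 1) : zetaZeroMult ρ = analyticOrderNatAt riemannZeta ρ := by
  have hne : ρ ≠ 1 := by rintro rfl; simp at h
  rw [zetaZeroMult, dif_pos (fz_zeta_an ρ hne)]
  rfl

lemma fz_fin (T : ℝ) : {ρ : ℂ | riemannZeta ρ = 0 ∧ 0 < ρ.re ∧ ρ.re < 1 ∧ 0 < ρ.im ∧ ρ.im ≤ T}.Finite := by
  have hK : IsCompact (Set.Icc (0:ℝ) 1 ×ℂ Set.Icc (0:ℝ) T) := isCompact_Icc.reProdIm isCompact_Icc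
  refine hK.inter_riemannZetaZeros_finite.subset ?_
  rintro ρ ⟨h1, h2, h3, h4, h5⟩
  refine ⟨?_, h1⟩
  rw [Complex.mem_reProdIm]
  exact ⟨⟨h2.le, h3.le⟩, ⟨h4.le, h5⟩⟩

/-- First zero-sum estimate in Section 3 of Ford–Zaharescu (zeros far from the critical
line). -/
theorem ford_zaharescu_far_zeros :
    ∃ C T₀ : ℝ, 0 < C ∧ ∀ T : ℝ, T₀ ≤ T → ∀ x : ℝ, 1 < x →
      (50 * Real.log (Real.log T) / Real.log T) * Real.log x < 1 →
      ‖∑ᶠ ρ ∈ {ρ : ℂ | riemannZeta ρ = 0 ∧ 0 < ρ.re ∧ ρ.re < 1 ∧ 0 < ρ.im ∧ ρ.im ≤ T ∧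
            50 * Real.log (Real.log T) / Real.log T ≤ |ρ.re - 1 / 2|},
          (zetaZeroMult ρ : ℂ) * ((x : ℂ) ^ (Complex.I * (ρ.im : ℂ)) *
            (1 - ((x ^ (ρ.re - 1 / 2) : ℝ) : ℂ)))‖ ≤
        C * T / Real.log T ^ 10 := by

  classical
  set C₀ := 2 * (3 * (144 * fzK + 32)) with hC₀
  have hC₀0 : 0 < C₀ := by have := fzK_pos; positivity
  set M₀ := ∑ ρ ∈ (fz_fin 4).toFinset, (analyticOrderNatAt riemannZeta ρ : ℝ) with hM₀
  have hM₀0 : 0 ≤ M₀ := Finset.sum_nonneg fun _ _ => Nat.cast_nonneg _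
  set D : ℝ := 2 ^ 10 * (Nat.factorial 10 : ℝ) with hD
  have hD0 : 0 < D := by positivity
  refine ⟨2 * C₀ + M₀ * D, Real.exp (Real.exp 2), by positivity, ?_⟩
  intro T hT x hx hxδ
  have hT0 : 0 < T := (Real.exp_pos _).trans_le hT
  set L := Real.log T with hL
  have hL2 : Real.exp 2 ≤ L := by rw [hL, Real.le_log_iff_exp_le hT0]; exact hT
  have hL0 : 0 < L := (Real.exp_pos _).trans_le hL2
  have hl2 : 2 ≤ Real.log L := by rwa [Real.le_log_iff_exp_le hL0]
  have hL4 : 4 ≤ L := by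
    have h1 : (2:ℝ) ≤ Real.exp 1 := by linarith [Real.add_one_le_exp 1]
    have h2 : Real.exp 2 = Real.exp 1 * Real.exp 1 := by rw [← Real.exp_add]; norm_num
    nlinarith
  set δ := 50 * Real.log L / L with hδ
  have hδ0 : 0 < δ := by positivity
  have hx0 : 0 < x := by linarith
  have hlx : Real.log x < 1 / δ := by rw [lt_div_iff₀ hδ0]; linarith
  have hlx0 : 0 < Real.log x := Real.log_pos hx
  set S : Set ℂ := {ρ : ℂ | riemannZeta ρ = 0 ∧ 0 < ρ.re ∧ ρ.re < 1 ∧ 0 < ρ.im ∧ ρ.im ≤ T ∧ δ ≤ |ρ.re - 1/2|} with hS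
  have hSf : S.Finite := (fz_fin T).subset fun ρ hρ => ⟨hρ.1, hρ.2.1, hρ.2.2.1, hρ.2.2.2.1, hρ.2.2.2.2.1⟩
  rw [finsum_mem_eq_finite_toFinset_sum _ hSf]
  set m : ℂ → ℝ := fun ρ => (analyticOrderNatAt riemannZeta ρ : ℝ) with hm
  have hm0 : ∀ ρ, 0 ≤ m ρ := fun ρ => Nat.cast_nonneg _
  -- pointwise weights
  have hterm : ∀ ρ ∈ hSf.toFinset, ‖(zetaZeroMult ρ : ℂ) * ((x : ℂ) ^ (Complex.I * (ρ.im : ℂ)) * (1 - ((x ^ (ρ.re - 1/2) : ℝ) : ℂ)))‖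
      = m ρ * |1 - x ^ (ρ.re - 1/2)| := by
    intro ρ hρ
    rw [hSf.mem_toFinset] at hρ
    rw [fz_mult ρ hρ.2.2.1, norm_mul, norm_mul, Complex.norm_natCast, Complex.norm_cpow_eq_rpow_re_of_pos hx0]
    have : ‖(1:ℂ) - ((x ^ (ρ.re - 1/2) : ℝ) : ℂ)‖ = |1 - x ^ (ρ.re - 1/2)| := by
      rw [← Complex.ofReal_one, ← Complex.ofReal_sub, Complex.norm_real, Real.norm_eq_abs]
    rw [this]
    simp [hm]
  have hpos : ∀ ρ : ℂ, 1/2 ≤ ρ.re → |1 - x ^ (ρ.re - 1/2)| ≤ Real.exp ((ρ.re - 1/2) / δ) := by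
    intro ρ hρ
    have h1 : 1 ≤ x ^ (ρ.re - 1/2) := Real.one_le_rpow hx.le (by linarith)
    have h2 : x ^ (ρ.re - 1/2) ≤ Real.exp ((ρ.re - 1/2) / δ) := by
      rw [Real.rpow_def_of_pos hx0]
      apply Real.exp_le_exp.2
      rw [le_div_iff₀ hδ0]
      have h3 : 0 ≤ ρ.re - 1/2 := by linarith
      nlinarith [mul_le_mul_of_nonneg_left hxδ.le h3]
    rw [abs_sub_comm, abs_of_nonneg (by linarith)]
    linarith
  have hneg : ∀ ρ : ℂ, ρ.re ≤ 1/2 → |1 - x ^ (ρ.re - 1/2)| ≤ 1 := by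
    intro ρ hρ
    have h1 : x ^ (ρ.re - 1/2) ≤ 1 := Real.rpow_le_one_of_one_le_of_nonpos hx.le (by linarith)
    have h2 : 0 < x ^ (ρ.re - 1/2) := Real.rpow_pos_of_pos hx0 _
    rw [abs_of_nonneg (by linarith)]
    linarith
  have hall : ∀ ρ : ℂ, ρ.re < 1 → |1 - x ^ (ρ.re - 1/2)| ≤ Real.exp (L/2) := by
    intro ρ hρ
    rcases le_total (1/2) ρ.re with h | h
    · refine (hpos ρ h).trans (Real.exp_le_exp.2 ?_)
      rw [div_le_iff₀ hδ0]
      have : L / 2 * δ = 25 * Real.log L := by rw [hδ]; field_simp; norm_num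
      rw [this]
      linarith
    · exact (hneg ρ h).trans (Real.one_le_exp (by linarith))
  have hsum : ‖∑ ρ ∈ hSf.toFinset, (zetaZeroMult ρ : ℂ) * ((x : ℂ) ^ (Complex.I * (ρ.im : ℂ)) * (1 - ((x ^ (ρ.re - 1/2) : ℝ) : ℂ)))‖
      ≤ ∑ ρ ∈ hSf.toFinset, m ρ * |1 - x ^ (ρ.re - 1/2)| := by
    refine (norm_sum_le _ _).trans (Finset.sum_le_sum fun ρ hρ => (hterm ρ hρ).le)
  refine hsum.trans ?_
  rw [← Finset.sum_filter_add_sum_filter_not hSf.toFinset (fun ρ => ρ.im < 4)]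
  rw [← Finset.sum_filter_add_sum_filter_not (hSf.toFinset.filter fun ρ => ¬ ρ.im < 4) (fun ρ => 1/2 ≤ ρ.re)]
  -- low zeros
  have hA : ∑ ρ ∈ hSf.toFinset.filter (fun ρ => ρ.im < 4), m ρ * |1 - x ^ (ρ.re - 1/2)| ≤ M₀ * D * T / L^10 := by
    have h1 : ∑ ρ ∈ hSf.toFinset.filter (fun ρ => ρ.im < 4), m ρ * |1 - x ^ (ρ.re - 1/2)| ≤ M₀ * Real.exp (L/2) := by
      rw [hM₀, Finset.sum_mul]
      calc _ ≤ ∑ ρ ∈ hSf.toFinset.filter (fun ρ => ρ.im < 4), m ρ * Real.exp (L/2) := by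
            refine Finset.sum_le_sum fun ρ hρ => ?_
            rw [Finset.mem_filter, hSf.mem_toFinset] at hρ
            exact mul_le_mul_of_nonneg_left (hall ρ hρ.1.2.2.1) (hm0 ρ)
        _ ≤ _ := by
            refine Finset.sum_le_sum_of_subset_of_nonneg ?_ fun ρ _ _ => mul_nonneg (hm0 ρ) (Real.exp_pos _).le
            intro ρ hρ
            rw [Finset.mem_filter, hSf.mem_toFinset] at hρ
            rw [(fz_fin 4).mem_toFinset]
            exact ⟨hρ.1.1, hρ.1.2.1, hρ.1.2.2.1, hρ.1.2.2.2.1, hρ.2.le⟩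
    refine h1.trans ?_
    have h2 := Real.pow_div_factorial_le_exp (L/2) (by linarith) 10
    have h3 : L ^ 10 ≤ D * Real.exp (L/2) := by
      rw [div_le_iff₀ (by positivity)] at h2
      have : L ^ 10 = 2^10 * (L/2)^10 := by ring
      rw [this, hD]
      nlinarith
    have h4 : T = Real.exp (L/2) * Real.exp (L/2) := by
      rw [← Real.exp_add, add_halves, hL, Real.exp_log hT0]
    rw [le_div_iff₀ (by positivity)]
    calc M₀ * Real.exp (L/2) * L^10 ≤ M₀ * Real.exp (L/2) * (D * Real.exp (L/2)) := by gcongr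
      _ = M₀ * D * (Real.exp (L/2) * Real.exp (L/2)) := by ring
      _ = M₀ * D * T := by rw [← h4]
  -- right zeros
  have hB : ∑ ρ ∈ (hSf.toFinset.filter (fun ρ => ¬ ρ.im < 4)).filter (fun ρ => 1/2 ≤ ρ.re), m ρ * |1 - x ^ (ρ.re - 1/2)|
      ≤ C₀ * T / L^10 := by
    refine le_trans (Finset.sum_le_sum fun ρ hρ => ?_) (fz_layer T hl2 hL4 hT0 δ hδ _ fun ρ hρ => ?_)
    · rw [Finset.mem_filter] at hρ
      exact mul_le_mul_of_nonneg_left (hpos ρ hρ.2) (hm0 ρ)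
    · rw [Finset.mem_filter, Finset.mem_filter, hSf.mem_toFinset] at hρ
      obtain ⟨⟨⟨h1, h2, h3, h4, h5, h6⟩, h7⟩, h8⟩ := hρ
      rw [abs_of_nonneg (by linarith)] at h6
      rw [abs_of_pos h4]
      exact ⟨h1, by linarith, h3, not_lt.1 h7, h5⟩
  -- left zeros
  have hC : ∑ ρ ∈ (hSf.toFinset.filter (fun ρ => ¬ ρ.im < 4)).filter (fun ρ => ¬ 1/2 ≤ ρ.re), m ρ * |1 - x ^ (ρ.re - 1/2)|
      ≤ C₀ * T / L^10 := by
    set Z := (hSf.toFinset.filter (fun ρ => ¬ ρ.im < 4)).filter (fun ρ => ¬ 1/2 ≤ ρ.re) with hZ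
    have hZ' : ∀ ρ ∈ Z, riemannZeta (1 - ρ) = 0 ∧ 0 < ρ.re ∧ ρ.re ≤ 1/2 - δ ∧ 4 ≤ ρ.im ∧ ρ.im ≤ T := by
      intro ρ hρ
      rw [hZ, Finset.mem_filter, Finset.mem_filter, hSf.mem_toFinset] at hρ
      obtain ⟨⟨⟨h1, h2, h3, h4, h5, h6⟩, h7⟩, h8⟩ := hρ
      rw [abs_of_neg (by linarith)] at h6
      refine ⟨?_, h2, by linarith, not_lt.1 h7, h5⟩
      rw [riemannZeta_one_sub (fun n e => ?_) (by rintro rfl; simp at h3), h1, mul_zero]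
      rw [e] at h4
      simp at h4
    have hLay := fz_layer T hl2 hL4 hT0 δ hδ (Z.image fun ρ => 1 - ρ) (by
      intro ρ' hρ'
      rw [Finset.mem_image] at hρ'
      obtain ⟨ρ, hρ, rfl⟩ := hρ'
      obtain ⟨h1, h2, h3, h4, h5⟩ := hZ' ρ hρ
      have e1 : (1 - ρ).re = 1 - ρ.re := by simp
      have e2 : |(1 - ρ).im| = ρ.im := by simp; linarith
      rw [e1, e2]
      exact ⟨h1, by linarith, by linarith, h4, h5⟩)
    rw [Finset.sum_image (fun a _ b _ h => by linear_combination -h)] at hLay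
    refine le_trans (Finset.sum_le_sum fun ρ hρ => ?_) hLay
    obtain ⟨h1, h2, h3, h4, h5⟩ := hZ' ρ hρ
    have h6 : m ρ ≤ (analyticOrderNatAt riemannZeta (1 - ρ) : ℝ) := by
      simp only [hm]
      exact_mod_cast fz_reflect ρ h2 (by linarith)
    refine mul_le_mul h6 ((hneg ρ (by linarith)).trans (Real.one_le_exp ?_)) (abs_nonneg _) (Nat.cast_nonneg _)
    simp only [Complex.sub_re, Complex.one_re]
    exact div_nonneg (by linarith) hδ0.le
  have : (2 * C₀ + M₀ * D) * T / L^10 = M₀ * D * T / L^10 + (C₀ * T / L^10 + C₀ * T / L^10) := by ring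
  rw [this]
  exact add_le_add hA (add_le_add hB hC)
end

section
/- Let p be prime and let a, q be coprime positive integers, and let g(t) = −((p^{a/2} cos(2πqt) − 1) log p)/(π(p^a − 2 p^{a/2} cos(2πqt) + 1)) for t ∈ [0,1). Then g attains its global minimum on [0,1) exactly at the points t = k/q for k = 0, 1, …, q−1, and the minimum value is g(k/q) = −(log p)/(π(p^{a/2} − 1)) < 0. -/
open Filter MeasureTheory Real Complex Set

/-- Equation (1.11) of Ford–Zaharescu: the global minimum of `g_α`. -/
theorem ford_zaharescu_min (p a q : ℕ) (hp : p.Prime) (ha : 0 < a) (hq : 0 < q)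
    (hco : Nat.Coprime a q) :
    (∀ t ∈ Set.Ico (0:ℝ) 1,
      -(Real.log p) / (π * ((p : ℝ) ^ ((a : ℝ) / 2) - 1)) ≤ gPAQ p a q t) ∧
    (∀ t ∈ Set.Ico (0:ℝ) 1,
      (gPAQ p a q t = -(Real.log p) / (π * ((p : ℝ) ^ ((a : ℝ) / 2) - 1)) ↔
        ∃ k : ℕ, k < q ∧ t = (k : ℝ) / q)) ∧
    -(Real.log p) / (π * ((p : ℝ) ^ ((a : ℝ) / 2) - 1)) < 0 := by
  have hL : 0 < Real.log p := Real.log_pos (by exact_mod_cast hp.one_lt)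
  have hp1 : (1:ℝ) < p := by exact_mod_cast hp.one_lt
  have ha' : (0:ℝ) < a := by exact_mod_cast ha
  have hq' : (0:ℝ) < q := by exact_mod_cast hq
  have hx : 1 < (p : ℝ) ^ ((a : ℝ) / 2) := Real.one_lt_rpow hp1 (by positivity)
  have hxx : (p : ℝ) ^ (a : ℝ) = (p : ℝ) ^ ((a : ℝ) / 2) * (p : ℝ) ^ ((a : ℝ) / 2) := by
    rw [← Real.rpow_add (by linarith)]
    congr 1
    ring
  have key : ∀ t : ℝ, ∃ C : ℝ, 0 < C ∧ gPAQ p a q t =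
      -(Real.log p) / (π * ((p : ℝ) ^ ((a : ℝ) / 2) - 1))
        + C * (1 - Real.cos (2 * π * q * t)) := by
    intro t
    unfold gPAQ
    rw [hxx]
    have hc := Real.cos_le_one (2 * π * q * t)
    generalize Real.cos (2 * π * q * t) = c at *
    generalize (p : ℝ) ^ ((a : ℝ) / 2) = x at *
    have hx1 : 0 < x - 1 := by linarith
    have hD : 0 < x * x - 2 * x * c + 1 := by
      nlinarith [mul_pos hx1 hx1, mul_nonneg (by linarith : (0:ℝ) ≤ x) (by linarith : 0 ≤ 1 - c)]
    have hpi := Real.pi_pos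
    refine ⟨Real.log p * (x * (x + 1)) / (π * ((x - 1) * (x * x - 2 * x * c + 1))), ?_, ?_⟩
    · have : 0 < x := by linarith
      positivity
    · have h1 := hx1.ne'
      have h2 := hD.ne'
      have h3 := hpi.ne'
      rw [div_mul_eq_mul_div, div_add_div _ _ (by positivity) (by positivity),
        div_eq_div_iff (by positivity) (by positivity)]
      ring
  refine ⟨?_, ?_, ?_⟩
  · intro t _
    obtain ⟨C, hC, h⟩ := key t
    rw [h]
    have := mul_nonneg hC.le (sub_nonneg.2 (Real.cos_le_one (2 * π * q * t)))
    linarith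
  · intro t ht
    obtain ⟨C, hC, h⟩ := key t
    rw [h, add_eq_left, mul_eq_zero, or_iff_right hC.ne', sub_eq_zero, eq_comm,
      Real.cos_eq_one_iff]
    have hpi := Real.pi_pos
    constructor
    · rintro ⟨n, hn⟩
      have hn' : (n : ℝ) = q * t := by
        have : (2 * π) * (n : ℝ) = (2 * π) * (q * t) := by linarith
        exact mul_left_cancel₀ (by positivity) this
      have h0 : (0:ℝ) ≤ n := by rw [hn']; exact mul_nonneg hq'.le ht.1
      have h0' : 0 ≤ n := by exact_mod_cast h0
      lift n to ℕ using h0'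
      refine ⟨n, ?_, ?_⟩
      · have : (n : ℝ) < q := by
          have := mul_lt_mul_of_pos_left ht.2 hq'
          push_cast at hn'
          linarith
        exact_mod_cast this
      · push_cast at hn'
        rw [hn']
        field_simp
    · rintro ⟨k, _, rfl⟩
      refine ⟨k, ?_⟩
      push_cast
      field_simp
  · have := Real.pi_pos
    exact div_neg_of_neg_of_pos (by linarith) (mul_pos this (by linarith))
end

section
/- Let p be prime and let a, q be coprime positive integers. For every t ∈ [0,1), the series −(log p/π) · Re ∑_{k=1}^∞ (p^{a/2} e^{2πiqt})^{−k} converges and equals −((p^{a/2} cos(2πqt) − 1) log p)/(π(p^a − 2 p^{a/2} cos(2πqt) + 1)), and moreover for every y ∈ [0,1], ∫₀^y of this function equals −(log p)/(2π²q) · arg(1 − p^{−a/2} e^{−2πiqy}), where arg denotes the principal argument. -/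
open Filter MeasureTheory Real Complex Set

theorem fz_den_pos (R θ : ℝ) (hR : 1 < R) : 0 < R ^ 2 - 2 * R * Real.cos θ + 1 := by
  nlinarith [Real.cos_le_one θ, mul_pos (sub_pos.2 hR) (sub_pos.2 hR)]

theorem fz_re (R θ : ℝ) :
    ((((R : ℂ) * Complex.exp (θ * Complex.I)) - 1)⁻¹).re
      = (R * Real.cos θ - 1) / (R ^ 2 - 2 * R * Real.cos θ + 1) := by
  have h1 : ((R : ℂ) * Complex.exp (θ * Complex.I) - 1).re = R * Real.cos θ - 1 := by
    simp [Complex.exp_ofReal_mul_I_re]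
  have h2 : ((R : ℂ) * Complex.exp (θ * Complex.I) - 1).im = R * Real.sin θ := by
    simp [Complex.exp_ofReal_mul_I_im]
  rw [Complex.inv_re, Complex.normSq_apply, h1, h2]
  congr 1
  nlinarith [Real.sin_sq_add_cos_sq θ]

theorem fz_sum (R θ : ℝ) (hR : 1 < R) :
    HasSum (fun k : ℕ => (((R : ℂ) * Complex.exp (θ * Complex.I)) ^ (-((k : ℤ) + 1))).re)
      ((R * Real.cos θ - 1) / (R ^ 2 - 2 * R * Real.cos θ + 1)) := by
  rw [← fz_re]
  set z := (R : ℂ) * Complex.exp (θ * Complex.I) with hz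
  have hn : ‖z‖ = R := by
    rw [hz, norm_mul, Complex.norm_exp_ofReal_mul_I, Complex.norm_real, Real.norm_eq_abs,
      abs_of_pos (by linarith), mul_one]
  have hz0 : z ≠ 0 := by
    intro h; rw [h, norm_zero] at hn; linarith
  have hz1 : z - 1 ≠ 0 := by
    intro h; rw [sub_eq_zero.1 h, norm_one] at hn; linarith
  have hlt : ‖z⁻¹‖ < 1 := by
    rw [norm_inv, hn]; exact inv_lt_one_of_one_lt₀ hR
  have hs := (hasSum_geometric_of_norm_lt_one hlt).mul_left z⁻¹
  have he : z⁻¹ * (1 - z⁻¹)⁻¹ = (z - 1)⁻¹ := by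
    rw [← mul_inv, mul_sub, mul_one, mul_inv_cancel₀ hz0]
  rw [he] at hs
  have := Complex.hasSum_re hs
  convert this using 3 with k
  rw [zpow_neg, ← Nat.cast_succ, zpow_natCast, ← inv_pow, pow_succ, mul_comm]

theorem fz_deriv (R w t : ℝ) (hR : 1 < R) :
    HasDerivAt (fun t : ℝ => Complex.arg (1 - ((R⁻¹ : ℝ) : ℂ) * Complex.exp (-((w * t : ℝ) : ℂ) * Complex.I)))
      (w * ((R * Real.cos (w * t) - 1) / (R ^ 2 - 2 * R * Real.cos (w * t) + 1))) t := by
  have hR0 : (R : ℂ) ≠ 0 := by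
    exact_mod_cast (by linarith : R ≠ 0)
  have hF : HasDerivAt (fun t : ℝ => 1 - ((R⁻¹ : ℝ) : ℂ) * Complex.exp (-((w * t : ℝ) : ℂ) * Complex.I))
      (-(((R⁻¹ : ℝ) : ℂ) * (Complex.exp (-((w * t : ℝ) : ℂ) * Complex.I) * (-((w * 1 : ℝ) : ℂ) * Complex.I)))) t := by
    exact ((((((hasDerivAt_id t).const_mul w).ofReal_comp).neg.mul_const Complex.I).cexp).const_mul _).const_sub 1
  have hn : ‖((R⁻¹ : ℝ) : ℂ) * Complex.exp (-((w * t : ℝ) : ℂ) * Complex.I)‖ < 1 := by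
    rw [norm_mul, ← Complex.ofReal_neg, Complex.norm_exp_ofReal_mul_I, Complex.norm_real,
      Real.norm_eq_abs, abs_of_pos (by positivity), mul_one]
    exact inv_lt_one_of_one_lt₀ hR
  have hs : 1 - ((R⁻¹ : ℝ) : ℂ) * Complex.exp (-((w * t : ℝ) : ℂ) * Complex.I) ∈ Complex.slitPlane := by
    have := Complex.mem_slitPlane_of_norm_lt_one (z := -(((R⁻¹ : ℝ) : ℂ) * Complex.exp (-((w * t : ℝ) : ℂ) * Complex.I))) (by rwa [norm_neg])
    rwa [← sub_eq_add_neg] at this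
  have hl := hF.clog_real hs
  have hi := Complex.imCLM.hasFDerivAt.comp_hasDerivAt t hl
  have hfun : (fun t : ℝ => Complex.arg (1 - ((R⁻¹ : ℝ) : ℂ) * Complex.exp (-((w * t : ℝ) : ℂ) * Complex.I)))
     = (⇑Complex.imCLM ∘ fun t : ℝ => Complex.log (1 - ((R⁻¹ : ℝ) : ℂ) * Complex.exp (-((w * t : ℝ) : ℂ) * Complex.I))) := by
    funext s; simp [Complex.log_im]
  rw [hfun]
  refine hi.congr_deriv (Eq.symm ?_)
  rw [← fz_re]
  have hz1 : (R : ℂ) * Complex.exp (((w * t : ℝ) : ℂ) * Complex.I) - 1 ≠ 0 := by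
    intro h
    have h2 := congrArg norm (sub_eq_zero.1 h)
    rw [norm_mul, Complex.norm_exp_ofReal_mul_I, Complex.norm_real, Real.norm_eq_abs,
      abs_of_pos (by linarith), norm_one] at h2
    linarith
  have hE := Complex.exp_ne_zero (((w * t : ℝ) : ℂ) * Complex.I)
  have : -(((R⁻¹ : ℝ) : ℂ) * (Complex.exp (-((w * t : ℝ) : ℂ) * Complex.I) * (-((w * 1 : ℝ) : ℂ) * Complex.I))) / (1 - ((R⁻¹ : ℝ) : ℂ) * Complex.exp (-((w * t : ℝ) : ℂ) * Complex.I))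
    = ((w : ℂ) * ((R : ℂ) * Complex.exp (((w * t : ℝ) : ℂ) * Complex.I) - 1)⁻¹) * Complex.I := by
    rw [div_eq_iff (Complex.slitPlane_ne_zero hs), neg_mul (((w * t : ℝ) : ℂ)), Complex.exp_neg, Complex.ofReal_inv]
    generalize Complex.exp (((w * t : ℝ) : ℂ) * Complex.I) = E at *
    field_simp
  rw [this, Complex.imCLM_apply, Complex.mul_I_im, Complex.re_ofReal_mul]

theorem fz_g (p a q : ℕ) (t : ℝ) : gPAQ p a q t = -(Real.log p / π) *
    (((p : ℝ) ^ ((a : ℝ) / 2) * Real.cos (2 * π * q * t) - 1) /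
      (((p : ℝ) ^ ((a : ℝ) / 2)) ^ 2 - 2 * (p : ℝ) ^ ((a : ℝ) / 2) * Real.cos (2 * π * q * t) + 1)) := by
  have h : ((p : ℝ) ^ ((a : ℝ) / 2)) ^ 2 = (p : ℝ) ^ (a : ℝ) := by
    rw [← Real.rpow_natCast, ← Real.rpow_mul (Nat.cast_nonneg p)]
    congr 1; push_cast; ring
  rw [gPAQ, h, ← neg_div, div_mul_div_comm]
  congr 1; ring

/-- Equation (1.8) of Ford–Zaharescu and the integral of `g_α`. -/
theorem ford_zaharescu_series (p a q : ℕ) (hp : p.Prime) (ha : 0 < a) (hq : 0 < q)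
    (hco : Nat.Coprime a q) :
    (∀ t ∈ Set.Ico (0:ℝ) 1,
      HasSum (fun k : ℕ => -(Real.log p / π) *
          (((((p : ℝ) ^ ((a : ℝ) / 2) : ℝ) : ℂ) *
              Complex.exp (2 * π * Complex.I * q * t)) ^ (-((k : ℤ) + 1))).re)
        (gPAQ p a q t)) ∧
    (∀ y ∈ Set.Icc (0:ℝ) 1,
      ∫ t in (0:ℝ)..y, gPAQ p a q t =
        -(Real.log p) / (2 * π ^ 2 * q) *
          Complex.arg (1 - (((p : ℝ) ^ (-(a : ℝ) / 2) : ℝ) : ℂ) *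
            Complex.exp (-(2 * π * q * y) * Complex.I))) := by
  have hR : 1 < (p : ℝ) ^ ((a : ℝ) / 2) :=
    Real.one_lt_rpow (by exact_mod_cast hp.one_lt) (by positivity)
  constructor
  · intro t _
    rw [fz_g]
    have := (fz_sum _ (2 * π * q * t) hR).mul_left (-(Real.log p / π))
    have he : Complex.exp (2 * π * Complex.I * q * t)
        = Complex.exp (((2 * π * q * t : ℝ) : ℂ) * Complex.I) := by
      congr 1
      push_cast
      ring
    rw [he]
    exact this
  · intro y _
    have hinv : (p : ℝ) ^ (-(a : ℝ) / 2) = ((p : ℝ) ^ ((a : ℝ) / 2))⁻¹ := by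
      rw [← Real.rpow_neg (Nat.cast_nonneg p), neg_div]
    rw [hinv]
    simp only [fz_g]
    generalize (p : ℝ) ^ ((a : ℝ) / 2) = R at *
    have hq' : (q : ℝ) ≠ 0 := by positivity
    have hd : ∀ t ∈ Set.uIcc (0 : ℝ) y, HasDerivAt (fun t : ℝ => -(Real.log p) / (2 * π ^ 2 * q) *
        Complex.arg (1 - ((R⁻¹ : ℝ) : ℂ) *
          Complex.exp (-((2 * π * q * t : ℝ) : ℂ) * Complex.I)))
        (-(Real.log p / π) * ((R * Real.cos (2 * π * q * t) - 1) /
          (R ^ 2 - 2 * R * Real.cos (2 * π * q * t) + 1))) t := by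
      intro t _
      refine ((fz_deriv R (2 * π * q) t hR).const_mul (-(Real.log p) / (2 * π ^ 2 * q))).congr_deriv (Eq.symm ?_)
      rw [← mul_assoc]
      congr 1
      have := Real.pi_ne_zero
      field_simp
    have hc : Continuous (fun t : ℝ => -(Real.log p / π) * ((R * Real.cos (2 * π * q * t) - 1) /
          (R ^ 2 - 2 * R * Real.cos (2 * π * q * t) + 1))) := by
      refine continuous_const.mul (Continuous.div (by fun_prop) (by fun_prop) ?_)
      intro t
      exact (fz_den_pos R _ hR).ne'
    rw [intervalIntegral.integral_eq_sub_of_hasDerivAt hd (hc.intervalIntegrable _ _)]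
    have h0 : Complex.arg (1 - ((R⁻¹ : ℝ) : ℂ) *
          Complex.exp (-((2 * π * q * (0:ℝ) : ℝ) : ℂ) * Complex.I)) = 0 := by
      have : 1 - ((R⁻¹ : ℝ) : ℂ) *
          Complex.exp (-((2 * π * q * (0:ℝ) : ℝ) : ℂ) * Complex.I) = ((1 - R⁻¹ : ℝ) : ℂ) := by
        simp
      rw [this]
      exact Complex.arg_ofReal_of_nonneg (sub_nonneg.2 (inv_le_one_of_one_le₀ hR.le))
    rw [h0, mul_zero, sub_zero]
    push_cast
    rfl
end
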